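/- arXiv:2004.09092 — 4 statements merged into one kernel-verified Lean document; each statement's English description precedes it below -/
import Mathlib

section
/- Let s be a Sturmian word over {a,b} and set c = max{b/a, a/b}. For any factors M, M' of s of the same length n with q_k ≤ n ≤ q_{k+1} − 1 (k ≥ 0), one has K(M) ≤ 2^{2k} · c · K(M'). -/
open Filter Real Matrix

noncomputable section

/-- `contQ w n` is the denominator `Q n` of the `n`-th convergent of the
continued fraction `[0; w 1, w 2, …]`. -/
def contQ (w : ℕ → ℕ) : ℕ → ℕ
  | 0 => 1
  | 1 => w 1
  | n + 2 => w (n + 2) * contQ w (n + 1) + contQ w n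

/-- The real number `[0; w 1, w 2, …]` has Lévy constant `ℓ`, i.e. the sequence
`(log Q n)/n` converges to `ℓ`. -/
def HasLevyConstant (w : ℕ → ℕ) (ℓ : ℝ) : Prop :=
  Tendsto (fun n : ℕ => Real.log (contQ w n) / n) atTop (nhds ℓ)

/-- `L` is a (finite) factor of the infinite word `w = w 1 w 2 ⋯`. -/
def IsFactorSeq (w : ℕ → ℕ) (L : List ℕ) : Prop :=
  ∃ i : ℕ, L = (List.range L.length).map fun j => w (i + j + 1)

/-- The complexity function `p(n, w)`: the number of distinct factors of length `n`. -/
def complexity (w : ℕ → ℕ) (n : ℕ) : ℕ :=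
  Set.ncard {L : List ℕ | L.length = n ∧ IsFactorSeq w L}

/-- The mechanical word `s_{θ,ρ}` over `{a,b}` (floor version), indexed from `1`. -/
def mechWord (a b : ℕ) (θ ρ : ℝ) (n : ℕ) : ℕ :=
  if ⌊(n : ℝ) * θ + ρ⌋ - ⌊((n : ℝ) - 1) * θ + ρ⌋ = 0 then a else b

/-- The mechanical word `s'_{θ,ρ}` over `{a,b}` (ceiling version), indexed from `1`. -/
def mechWord' (a b : ℕ) (θ ρ : ℝ) (n : ℕ) : ℕ :=
  if ⌈(n : ℝ) * θ + ρ⌉ - ⌈((n : ℝ) - 1) * θ + ρ⌉ = 0 then a else b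

/-- `w` is a Sturmian word over `{a, b}`: a mechanical word with irrational slope. -/
def IsSturmianWord (a b : ℕ) (w : ℕ → ℕ) : Prop :=
  ∃ θ ρ : ℝ, Irrational θ ∧ θ ∈ Set.Icc (0 : ℝ) 1 ∧ ρ ∈ Set.Ico (0 : ℝ) 1 ∧
    (w = mechWord a b θ ρ ∨ w = mechWord' a b θ ρ)

/-- The matrix `[[x, 1], [1, 0]]`. -/
def cfMat (x : ℝ) : Matrix (Fin 2) (Fin 2) ℝ := !![x, 1; 1, 0]

/-- `T(b₁, …, b_n)`: the trace of `[[b₁,1],[1,0]] ⋯ [[b_n,1],[1,0]]` for a word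
`b₁ ⋯ b_n` over the positive integers.  The trace of the empty word is `2`. -/
def traceWord (L : List ℕ) : ℝ := ((L.map fun c => cfMat (c : ℝ)).prod).trace

/-- The polynomial `𝐓_n(x) = Tr([[x,1],[1,0]]^n)`. -/
def Tpoly (n : ℕ) (x : ℝ) : ℝ := ((cfMat x) ^ n).trace

/-- The lower Christoffel word `w_{p/q}` over `{a, b}`: the prefix of length `q`
of the mechanical word `s_{p/q, 0}`. -/
def christoffel (a b p q : ℕ) : List ℕ :=
  (List.range q).map fun n => mechWord a b ((p : ℝ) / (q : ℝ)) 0 (n + 1)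

/-- `T(w_{p/q})`, the trace attached to the lower Christoffel word of slope `p/q`. -/
def Tw (a b p q : ℕ) : ℝ := traceWord (christoffel a b p q)

/-- The continuant `K(b₁, …, b_n)`: the denominator of `[0; b₁, …, b_n]`. -/
def contList : List ℕ → ℕ
  | [] => 1
  | [x] => x
  | x :: y :: t => x * contList (y :: t) + contList t

/-- The standard words attached to `d₁, d₂, …` : `sturmM a b d (k+1)` is the word
`M_k`, where `M_{-1} = b`, `M_0 = a` and `M_k = M_{k-1}^{d_k} M_{k-2}`. -/
def sturmM (a b : ℕ) (d : ℕ → ℕ) : ℕ → List ℕ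
  | 0 => [b]
  | 1 => [a]
  | k + 2 => (List.replicate (d (k + 1)) (sturmM a b d (k + 1))).flatten ++ sturmM a b d k

/-- Denominators `q_k` of the convergents of `θ = [0; 1 + d₁, d₂, d₃, …]`. -/
def cfQ (d : ℕ → ℕ) : ℕ → ℕ
  | 0 => 1
  | 1 => 1 + d 1
  | k + 2 => d (k + 2) * cfQ d (k + 1) + cfQ d k

/-- Numerators `p_k` of the convergents of `θ = [0; 1 + d₁, d₂, d₃, …]`. -/
def cfP (d : ℕ → ℕ) : ℕ → ℕ
  | 0 => 0
  | 1 => 1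
  | k + 2 => d (k + 2) * cfP d (k + 1) + cfP d k

/-- `w` is ultimately periodic (so that `[0; w 1, w 2, …]` is a quadratic irrational). -/
def UltimatelyPeriodic (w : ℕ → ℕ) : Prop :=
  ∃ r s : ℕ, 0 < s ∧ ∀ n, r < n → w (n + s) = w n

end

lemma contList_le_cons (y : ℕ) (hy : 0 < y) : ∀ v : List ℕ, contList v ≤ contList (y :: v)
  | [] => by simp only [contList]; omega
  | z :: t => by
    simp only [contList]
    nlinarith [Nat.zero_le (contList (z :: t))]

lemma contList_mul_le_append :
    ∀ u v : List ℕ, contList u * contList v ≤ contList (u ++ v)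
  | [], v => by simp [contList]
  | [x], [] => by simp [contList]
  | [x], y :: v => by simp [contList]
  | x :: y :: t, v => by
    have h₁ := contList_mul_le_append (y :: t) v
    have h₂ := contList_mul_le_append t v
    simp only [List.cons_append, contList] at h₁ ⊢
    nlinarith [Nat.mul_le_mul_left x h₁]

lemma contList_append_le : ∀ u v : List ℕ, (∀ x ∈ u, 0 < x) → (∀ x ∈ v, 0 < x) →
    contList (u ++ v) ≤ 2 * (contList u * contList v)
  | [], v, _, _ => by simp only [List.nil_append, contList]; omega
  | [x], [], _, _ => by simp only [List.append_nil, contList]; omega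
  | [x], y :: v, hu, hv => by
    have hx : 0 < x := hu x (by simp)
    have hy := contList_le_cons y (hv y (by simp)) v
    simp only [List.cons_append, List.nil_append, contList]
    nlinarith [Nat.zero_le (contList (y :: v))]
  | x :: y :: t, v, hu, hv => by
    have h₁ := contList_append_le (y :: t) v (fun z hz => hu z (by simp_all)) hv
    have h₂ := contList_append_le t v (fun z hz => hu z (by simp_all)) hv
    simp only [List.cons_append, contList] at h₁ ⊢
    nlinarith [Nat.mul_le_mul_left x h₁]

/-- Changing one letter by a factor at most `c` changes the continuant by a factor at most `c`. -/
lemma contList_change_letter {c : ℝ} (hc : 1 ≤ c) {x y : ℕ} (hxy : (x : ℝ) ≤ c * y)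
    (v : List ℕ) : ∀ u : List ℕ,
    (contList (u ++ x :: v) : ℝ) ≤ c * contList (u ++ y :: v)
  | [] => by
    cases v with
    | nil => simpa [contList] using hxy
    | cons w t =>
      simp only [List.nil_append, contList]
      push_cast
      have h₁ : (0 : ℝ) ≤ contList (w :: t) := Nat.cast_nonneg _
      have h₂ : (0 : ℝ) ≤ contList t := Nat.cast_nonneg _
      nlinarith
  | [z] => by
    have h := contList_change_letter hc hxy v []
    simp only [List.cons_append, List.nil_append, contList] at h ⊢
    push_cast
    have h₁ : (0 : ℝ) ≤ contList v := Nat.cast_nonneg _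
    have h₂ : (0 : ℝ) ≤ z := Nat.cast_nonneg _
    nlinarith [mul_le_mul_of_nonneg_left h h₂]
  | z :: w :: t => by
    have h := contList_change_letter hc hxy v (w :: t)
    have h' := contList_change_letter hc hxy v t
    simp only [List.cons_append, contList] at h ⊢
    push_cast
    have h₂ : (0 : ℝ) ≤ z := Nat.cast_nonneg _
    nlinarith [mul_le_mul_of_nonneg_left h h₂]

/-- The word of length `n` starting at position `i` that records whether the increments of `h`
vanish (letter `a`) or not (letter `b`). -/
def diffWord (a b : ℕ) (h : ℕ → ℤ) (i n : ℕ) : List ℕ :=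
  (List.range n).map fun j => if h (i + j + 1) - h (i + j) = 0 then a else b

lemma diffWord_add (a b : ℕ) (h : ℕ → ℤ) (i m n : ℕ) :
    diffWord a b h i (m + n) = diffWord a b h i m ++ diffWord a b h (i + m) n := by
  simp [diffWord, List.range_add, Function.comp_def, add_assoc]

lemma diffWord_one (a b : ℕ) (h : ℕ → ℤ) (i : ℕ) :
    diffWord a b h i 1 = [if h (i + 1) - h i = 0 then a else b] := by
  simp [diffWord]

lemma diffWord_succ (a b : ℕ) (h : ℕ → ℤ) (i n : ℕ) :
    diffWord a b h i (n + 1) =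
      (if h (i + 1) - h i = 0 then a else b) :: diffWord a b h (i + 1) n := by
  rw [add_comm n 1, diffWord_add, diffWord_one, List.singleton_append]

lemma diffWord_congr (a b : ℕ) {h g : ℕ → ℤ} {i i' n : ℕ} (t : ℤ)
    (H : ∀ j ≤ n, h (i + j) = g (i' + j) + t) :
    diffWord a b h i n = diffWord a b g i' n := by
  refine List.map_congr_left fun j hj => ?_
  have hj := List.mem_range.1 hj
  have h₁ := H j hj.le
  have h₂ := H (j + 1) hj
  rw [← add_assoc, ← add_assoc] at h₂
  rw [h₁, h₂]
  congr 2
  ring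

lemma diffWord_neg (a b : ℕ) (h : ℕ → ℤ) (i n : ℕ) :
    diffWord a b (fun j => -h j - 1) i n = diffWord a b h i n := by
  refine List.map_congr_left fun j _ => ?_
  congr 1
  apply propext
  constructor <;> intro h <;> linarith

lemma diffWord_letters_pos {a b : ℕ} (ha : 0 < a) (hb : 0 < b) (h : ℕ → ℤ) (i n : ℕ) :
    ∀ x ∈ diffWord a b h i n, 0 < x := by
  intro x hx
  obtain ⟨j, -, rfl⟩ := List.mem_map.1 hx
  split_ifs <;> assumption

lemma diffWord_const {a b : ℕ} {h : ℕ → ℤ} (hm : ∀ j, h j ≤ h (j + 1)) :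
    ∀ n i, h (i + n) ≤ h i → diffWord a b h i n = List.replicate n a
  | 0, i, _ => by simp [diffWord]
  | n + 1, i, H => by
    have hmono : Monotone h := monotone_nat_of_le_succ hm
    have h₁ := hm i
    have h₂ : h (i + 1) ≤ h (i + 1 + n) := hmono (by omega)
    have h₃ : i + (n + 1) = i + 1 + n := by ring
    rw [h₃] at H
    rw [diffWord_succ, if_pos (by linarith), diffWord_const hm n (i + 1) (by linarith),
      List.replicate_succ]

lemma diffWord_of_le_one {a b : ℕ} {h : ℕ → ℤ} (hm : ∀ j, h j ≤ h (j + 1)) :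
    ∀ n i, h (i + n) ≤ h i + 1 → diffWord a b h i n = List.replicate n a ∨
      ∃ u v : ℕ, u + 1 + v = n ∧
        diffWord a b h i n = List.replicate u a ++ b :: List.replicate v a
  | 0, i, _ => by simp [diffWord]
  | n + 1, i, H => by
    have h₁ := hm i
    have h₃ : i + (n + 1) = i + 1 + n := by ring
    rw [h₃] at H
    rw [diffWord_succ]
    by_cases h₀ : h (i + 1) - h i = 0
    · rw [if_pos h₀]
      rcases diffWord_of_le_one hm n (i + 1) (by linarith) with e | ⟨u, v, huv, e⟩
      · left
        rw [e, List.replicate_succ]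
      · right
        refine ⟨u + 1, v, by omega, ?_⟩
        rw [e, List.replicate_succ, List.cons_append]
    · right
      have h₄ : h i < h (i + 1) := by omega
      refine ⟨0, n, by omega, ?_⟩
      rw [if_neg h₀, diffWord_const hm n (i + 1) (by linarith)]
      simp

/-- Two words with at most one letter `b` each and all other letters equal to `a`. -/
lemma contList_diffWord_le_of_le_one {a b : ℕ} {h : ℕ → ℤ} (hm : ∀ j, h j ≤ h (j + 1)) {c : ℝ}
    (hc : 1 ≤ c) (hcab : (a : ℝ) ≤ c * b) (hcba : (b : ℝ) ≤ c * a) {n i i' : ℕ}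
    (hi : h (i + n) ≤ h i + 1) (hi' : h (i' + n) ≤ h i' + 1) :
    (contList (diffWord a b h i n) : ℝ) ≤ c * contList (diffWord a b h i' n) := by
  have hrep : ∀ u v : ℕ, u + 1 + v = n →
      List.replicate u a ++ a :: List.replicate v a = List.replicate n a := by
    rintro u v rfl
    rw [← List.replicate_succ, ← List.replicate_add]
    congr 1
    ring
  have key : ∀ d : ℝ, 1 ≤ d → ∀ l, h (l + n) ≤ h l + 1 →
      ((b : ℝ) ≤ d * a →
        (contList (diffWord a b h l n) : ℝ) ≤ d * contList (List.replicate n a)) ∧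
      ((a : ℝ) ≤ d * b →
        (contList (List.replicate n a) : ℝ) ≤ d * contList (diffWord a b h l n)) := by
    intro d hd l hl
    rcases diffWord_of_le_one (a := a) (b := b) hm n l hl with e | ⟨u, v, huv, e⟩
    · rw [e]
      have : (0 : ℝ) ≤ contList (List.replicate n a) := Nat.cast_nonneg _
      constructor <;> intro _ <;> nlinarith
    · rw [e, ← hrep u v huv]
      exact ⟨fun hd' => contList_change_letter hd hd' _ _,
        fun hd' => contList_change_letter hd hd' _ _⟩
  rcases le_total (a : ℝ) b with hab | hab
  · have h₁ := (key c hc i hi).1 hcba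
    have h₂ := (key 1 le_rfl i' hi').2 (by linarith)
    nlinarith
  · have h₁ := (key 1 le_rfl i hi).1 (by linarith)
    have h₂ := (key c hc i' hi').2 hcab
    linarith

/-- The periodic words of slope `p / N` with different intercepts are conjugate, hence their
continuants differ by a factor at most `2`. -/
lemma contList_rational_le {a b : ℕ} (ha : 0 < a) (hb : 0 < b) {p : ℤ} {N : ℕ} (hN : 0 < N)
    {p' N' : ℤ} (hdet : p' * N - p * N' = 1) (m m' : ℤ) :
    contList (diffWord a b (fun j => (m + j * p) / N) 0 N) ≤
      2 * contList (diffWord a b (fun j => (m' + j * p) / N) 0 N) := by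
  have hNz : (N : ℤ) ≠ 0 := by positivity
  obtain ⟨t, ht⟩ : ∃ t : ℕ, (t : ℤ) = (-N' * (m - m')) % N :=
    ⟨_, Int.toNat_of_nonneg (Int.emod_nonneg _ hNz)⟩
  have htN : t < N := by
    have := Int.emod_lt_of_pos (-N' * (m - m')) (show (0 : ℤ) < N by positivity)
    omega
  obtain ⟨q, hq⟩ : ∃ q : ℤ, m = m' + t * p + N * q := by
    have h₁ := Int.emod_add_mul_ediv (-N' * (m - m')) N
    rw [← ht] at h₁
    refine ⟨p' * (m - m') + p * (-N' * (m - m') / N), ?_⟩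
    linear_combination (-(m - m')) * hdet - p * h₁
  have e₁ : diffWord a b (fun j => (m + j * p) / N) 0 N =
      diffWord a b (fun j => (m' + j * p) / N) t N := by
    refine diffWord_congr a b q fun j _ => ?_
    have : m + ((0 + j : ℕ) : ℤ) * p = (m' + ((t + j : ℕ) : ℤ) * p) + N * q := by
      rw [hq]; push_cast; ring
    simp only [this]
    rw [Int.add_mul_ediv_left _ _ hNz]
  have e₂ : diffWord a b (fun j => (m' + j * p) / N) N t =
      diffWord a b (fun j => (m' + j * p) / N) 0 t := by
    refine diffWord_congr a b p fun j _ => ?_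
    have : m' + ((N + j : ℕ) : ℤ) * p = (m' + ((0 + j : ℕ) : ℤ) * p) + N * p := by
      push_cast; ring
    simp only [this]
    rw [Int.add_mul_ediv_left _ _ hNz]
  have e₃ : diffWord a b (fun j => (m' + j * p) / N) t N =
      diffWord a b (fun j => (m' + j * p) / N) t (N - t) ++
        diffWord a b (fun j => (m' + j * p) / N) 0 t := by
    conv_lhs => rw [show N = (N - t) + t by omega]
    rw [diffWord_add, show t + (N - t) = N by omega, show N - t + t = N by omega, e₂]
  have e₄ : diffWord a b (fun j => (m' + j * p) / N) 0 N =
      diffWord a b (fun j => (m' + j * p) / N) 0 t ++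
        diffWord a b (fun j => (m' + j * p) / N) t (N - t) := by
    conv_lhs => rw [show N = t + (N - t) by omega]
    rw [diffWord_add, show 0 + t = t by omega, show t + (N - t) = N by omega]
  rw [e₁, e₃, e₄]
  refine (contList_append_le _ _ (diffWord_letters_pos ha hb _ _ _)
    (diffWord_letters_pos ha hb _ _ _)).trans ?_
  rw [mul_comm (contList _)]
  exact Nat.mul_le_mul_left 2 (contList_mul_le_append _ _)

section Farey

variable {θ ρ : ℝ} {h : ℕ → ℤ} {p p' : ℤ} {N N' : ℕ}

lemma farey_strict (hh : ∀ j : ℕ, (h j : ℝ) ≤ j * θ + ρ ∧ j * θ + ρ ≤ h j + 1)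
    (hN : 0 < N) (hN' : 0 < N') (hdet : p' * N - p * N' = 1) (hp : (p : ℝ) < N * θ)
    (hp' : N' * θ < p') (i : ℕ) {x y : ℕ} (hx : x ≤ N) (hy : y ≤ N)
    (hxy : h (i + N) = h i + p ∨ x < N ∨ 0 < y) :
    N * h (i + x) - x * p < N * (h (i + y) + 1) - y * p := by
  have hNR : (0 : ℝ) < N := by exact_mod_cast hN
  obtain ⟨hx₁, hx₂⟩ := hh (i + x)
  obtain ⟨hy₁, hy₂⟩ := hh (i + y)
  push_cast at hx₁ hx₂ hy₁ hy₂
  rcases lt_trichotomy x y with hlt | rfl | hlt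
  · have hlt' : (x : ℝ) < y := by exact_mod_cast hlt
    have h₁ : (y - x : ℝ) * θ ≤ h (i + y) - h (i + x) + 1 := by linarith
    have h₂ : (y - x : ℝ) * p < N * ((y - x : ℝ) * θ) := by nlinarith
    have h₃ : (y - x : ℝ) * p < N * (h (i + y) - h (i + x) + 1) := by nlinarith
    have h₄ : (N * h (i + x) - x * p : ℝ) < N * (h (i + y) + 1) - y * p := by linarith
    exact_mod_cast h₄
  · have : (0 : ℤ) < N := by exact_mod_cast hN
    linarith
  · by_contra! hcon
    obtain ⟨l, rfl⟩ : ∃ l, x = y + l := ⟨x - y, by omega⟩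
    have hl : 0 < l := by omega
    set z : ℤ := h (i + (y + l)) - h (i + y) - 1 with hz
    have hNZ : (0 : ℤ) < N := by exact_mod_cast hN
    have hlZ : (0 : ℤ) < l := by exact_mod_cast hl
    have hNZ' : (0 : ℤ) < N' := by exact_mod_cast hN'
    have hcon' : (l : ℤ) * p ≤ N * z := by
      push_cast at hcon
      rw [hz]; linarith
    have hzθ : (z : ℝ) ≤ l * θ := by
      rw [hz]; push_cast at hx₁ hx₂ ⊢; linarith
    have hzp : (z : ℝ) * N' < l * p' := by
      have h₁ : (0 : ℝ) < l := by exact_mod_cast hl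
      have h₂ : (0 : ℝ) < N' := by exact_mod_cast hN'
      nlinarith
    have hzp' : z * N' + 1 ≤ l * p' := by exact_mod_cast hzp
    have hid : (l : ℤ) = N * (l * p' - z * N') + N' * (N * z - l * p) := by
      linear_combination (-(l : ℤ)) * hdet
    have hlN : (l : ℤ) ≤ N := by exact_mod_cast (by omega : l ≤ N)
    have h0 : N * z - l * p = 0 := by
      by_contra hne
      have h1 : 1 ≤ N * z - l * p := by omega
      nlinarith
    rw [h0] at hid
    have hlN' : (l : ℤ) = N := by nlinarith
    have hl' : l = N := by exact_mod_cast hlN'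
    have hy0 : y = 0 := by omega
    subst hy0 hl'
    rcases hxy with hxy | hxy | hxy
    · have : z = p - 1 := by rw [hz]; simp only [zero_add, add_zero]; linarith
      rw [this] at h0
      nlinarith
    · omega
    · omega

lemma eq_rational_of_regular (hh : ∀ j : ℕ, (h j : ℝ) ≤ j * θ + ρ ∧ j * θ + ρ ≤ h j + 1)
    (hN : 0 < N) (hN' : 0 < N') (hdet : p' * N - p * N' = 1) (hp : (p : ℝ) < N * θ)
    (hp' : N' * θ < p') (i : ℕ) (hreg : h (i + N) = h i + p) :
    ∃ m : ℤ, ∀ j ≤ N, h (i + j) = (m + j * p) / N := by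
  have hNZ : (0 : ℤ) < N := by exact_mod_cast hN
  obtain ⟨x, hx, hmax⟩ := Finset.exists_max_image (Finset.range (N + 1))
    (fun x => (N * h (i + x) - x * p : ℤ)) ⟨0, by simp⟩
  refine ⟨N * h (i + x) - x * p, fun j hj => ?_⟩
  have h₁ := hmax j (Finset.mem_range.2 (by omega))
  have h₂ := farey_strict hh hN hN' hdet hp hp' i (x := x) (y := j)
    (by have := Finset.mem_range.1 hx; omega) hj (Or.inl hreg)
  symm
  rw [Int.ediv_eq_iff_of_pos hNZ]
  constructor <;> linarith

lemma eq_rational_of_singular (hh : ∀ j : ℕ, (h j : ℝ) ≤ j * θ + ρ ∧ j * θ + ρ ≤ h j + 1)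
    (hN : 0 < N) (hN' : 0 < N') (hdet : p' * N - p * N' = 1) (hp : (p : ℝ) < N * θ)
    (hp' : N' * θ < p') (i : ℕ) (hsing : h (i + N) = h i + p + 1) {j : ℕ} (hj : 0 < j)
    (hjN : j ≤ N) : h (i + j) = (0 + j * p) / N + (h i + 1) := by
  have hNZ : (0 : ℤ) < N := by exact_mod_cast hN
  have h₂ := farey_strict hh hN hN' hdet hp hp' i (x := N) (y := j) le_rfl hjN
    (Or.inr (Or.inr hj))
  have h₁ : N * h (i + j) - j * p ≤ N * (h i + 1) := by
    rcases hjN.lt_or_eq with hlt | rfl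
    · have := farey_strict hh hN hN' hdet hp hp' i (x := j) (y := 0) hjN (Nat.zero_le _)
        (Or.inr (Or.inl hlt))
      simp only [add_zero] at this
      push_cast at this
      linarith
    · rw [hsing]; linarith
  rw [hsing] at h₂
  have : (0 + j * p : ℤ) / N = h (i + j) - (h i + 1) := by
    rw [Int.ediv_eq_iff_of_pos hNZ]
    constructor <;> linarith
  linarith

lemma regular_or_singular (hh : ∀ j : ℕ, (h j : ℝ) ≤ j * θ + ρ ∧ j * θ + ρ ≤ h j + 1)
    (hN : 0 < N) (hN' : 0 < N') (hdet : p' * N - p * N' = 1) (hp : (p : ℝ) < N * θ)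
    (hp' : N' * θ < p') (i : ℕ) : h (i + N) = h i + p ∨ h (i + N) = h i + p + 1 := by
  obtain ⟨hx₁, hx₂⟩ := hh (i + N)
  obtain ⟨hy₁, hy₂⟩ := hh i
  push_cast at hx₁ hx₂
  have hdetR : (p' * N - p * N' : ℝ) = 1 := by exact_mod_cast hdet
  have hNR : (1 : ℝ) ≤ N := by exact_mod_cast hN
  have hNR' : (1 : ℝ) ≤ N' := by exact_mod_cast hN'
  have hε : N * θ < p + 1 := by
    by_contra! hcon
    nlinarith
  have h₁ : (h i + p : ℝ) < h (i + N) + 1 := by linarith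
  have h₂ : (h (i + N) : ℝ) < h i + p + 2 := by linarith
  have h₁' : h i + p < h (i + N) + 1 := by exact_mod_cast h₁
  have h₂' : h (i + N) < h i + p + 2 := by exact_mod_cast h₂
  omega

lemma regular_of_singular (hh : ∀ j : ℕ, (h j : ℝ) ≤ j * θ + ρ ∧ j * θ + ρ ≤ h j + 1)
    (hNN' : N' ≤ N) (hN' : 0 < N') (hdet : p' * N - p * N' = 1) (hp : (p : ℝ) < N * θ)
    (hp' : N' * θ < p') (i : ℕ) (hsing : h (i + N) = h i + p + 1) {r : ℕ} (hr : 0 < r)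
    (hrN : r < N') : h (i + r + N) = h (i + r) + p := by
  rcases regular_or_singular hh (by omega) hN' hdet hp hp' (i + r) with h' | h'
  · exact h'
  exfalso
  obtain ⟨hx₁, hx₂⟩ := hh (i + N)
  obtain ⟨hy₁, hy₂⟩ := hh i
  obtain ⟨hz₁, hz₂⟩ := hh (i + r + N)
  obtain ⟨hw₁, hw₂⟩ := hh (i + r)
  rw [hsing] at hx₁
  rw [h'] at hz₁
  push_cast at hx₁ hz₁ hw₁ hw₂
  set z : ℤ := h (i + r) - h i with hz
  have hzR : (z : ℝ) = h (i + r) - h i := by rw [hz]; push_cast; ring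
  have b₁ : r * θ - z ≤ N * θ - p := by linarith
  have b₂ : -(N * θ - p) ≤ r * θ - z := by linarith
  set α : ℤ := p' * r - N' * z with hα
  set β : ℤ := N * z - p * r with hβ
  have hr' : (r : ℤ) = α * N + β * N' := by
    rw [hα, hβ]; linear_combination (-(r : ℤ)) * hdet
  have hz' : z = α * p + β * p' := by
    rw [hα, hβ]; linear_combination (-z) * hdet
  have hrR : (r : ℝ) = α * N + β * N' := by exact_mod_cast hr'
  have hzR' : (z : ℝ) = α * p + β * p' := by exact_mod_cast hz'
  have hid : r * θ - z = α * (N * θ - p) - β * (p' - N' * θ) := by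
    rw [hrR, hzR']; ring
  rw [hid] at b₁ b₂
  have hε : 0 < N * θ - p := by linarith
  have hδ : 0 < p' - N' * θ := by linarith
  have hrZ : (0 : ℤ) < r := by exact_mod_cast hr
  have hrN'Z : (r : ℤ) < N' := by exact_mod_cast hrN
  have hNN'Z : (N' : ℤ) ≤ N := by exact_mod_cast hNN'
  have hN'Z : (0 : ℤ) < N' := by exact_mod_cast hN'
  have hNZ : (0 : ℤ) < N := by omega
  rcases lt_trichotomy α 0 with h0 | h0 | h0
  · have hβ1 : 1 ≤ β := by
      by_contra! hcon
      nlinarith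
    have h1 : (α : ℝ) ≤ -1 := by exact_mod_cast (by omega : α ≤ -1)
    have h2 : (1 : ℝ) ≤ β := by exact_mod_cast hβ1
    nlinarith
  · rw [h0] at hr'
    rcases le_or_gt β 0 with h1 | h1 <;> nlinarith
  · have hβ1 : β ≤ -1 := by
      by_contra! hcon
      nlinarith
    have h1 : (1 : ℝ) ≤ α := by exact_mod_cast h0
    have h2 : (β : ℝ) ≤ -1 := by exact_mod_cast hβ1
    nlinarith

variable {a b : ℕ} {c : ℝ}

lemma contList_regular_le (ha : 0 < a) (hb : 0 < b)
    (hh : ∀ j : ℕ, (h j : ℝ) ≤ j * θ + ρ ∧ j * θ + ρ ≤ h j + 1)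
    (hN : 0 < N) (hN' : 0 < N') (hdet : p' * N - p * N' = 1) (hp : (p : ℝ) < N * θ)
    (hp' : N' * θ < p') {i i' : ℕ} (hi : h (i + N) = h i + p) (hi' : h (i' + N) = h i' + p) :
    contList (diffWord a b h i N) ≤ 2 * contList (diffWord a b h i' N) := by
  obtain ⟨m, hm⟩ := eq_rational_of_regular hh hN hN' hdet hp hp' i hi
  obtain ⟨m', hm'⟩ := eq_rational_of_regular hh hN hN' hdet hp hp' i' hi'
  have e : diffWord a b h i N = diffWord a b (fun j => (m + j * p) / N) 0 N :=
    diffWord_congr a b 0 fun j hj => by simp [hm j hj]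
  have e' : diffWord a b h i' N = diffWord a b (fun j => (m' + j * p) / N) 0 N :=
    diffWord_congr a b 0 fun j hj => by simp [hm' j hj]
  rw [e, e']
  exact contList_rational_le ha hb hN hdet m m'

lemma contList_window_le (ha : 0 < a) (hb : 0 < b) (hc : 1 ≤ c) (hcab : (a : ℝ) ≤ c * b)
    (hcba : (b : ℝ) ≤ c * a) (hh : ∀ j : ℕ, (h j : ℝ) ≤ j * θ + ρ ∧ j * θ + ρ ≤ h j + 1)
    (hN : 0 < N) (hN' : 0 < N') (hdet : p' * N - p * N' = 1) (hp : (p : ℝ) < N * θ)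
    (hp' : N' * θ < p') (i i' : ℕ) :
    (contList (diffWord a b h i N) : ℝ) ≤ 2 * c * contList (diffWord a b h i' N) := by
  have letter : ∀ x y : ℕ, x = a ∨ x = b → y = a ∨ y = b → (x : ℝ) ≤ c * y := by
    intro x y hx hy
    have h₁ : (0 : ℝ) ≤ a := Nat.cast_nonneg _
    have h₂ : (0 : ℝ) ≤ b := Nat.cast_nonneg _
    rcases hx with rfl | rfl <;> rcases hy with rfl | rfl <;> nlinarith
  have hrat : ∀ m m' : ℤ, (contList (diffWord a b (fun j => (m + j * p) / N) 0 N) : ℝ) ≤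
      2 * contList (diffWord a b (fun j => (m' + j * p) / N) 0 N) := fun m m' => by
    exact_mod_cast contList_rational_le ha hb hN hdet m m'
  have hreg : ∀ l, h (l + N) = h l + p →
      ∃ m : ℤ, diffWord a b h l N = diffWord a b (fun j => (m + j * p) / N) 0 N := fun l hl => by
    obtain ⟨m, hm⟩ := eq_rational_of_regular hh hN hN' hdet hp hp' l hl
    exact ⟨m, diffWord_congr a b 0 fun j hj => by simp [hm j hj]⟩
  obtain ⟨M, rfl⟩ : ∃ M, N = M + 1 := ⟨N - 1, by omega⟩
  have hsing : ∀ l, h (l + (M + 1)) = h l + p + 1 → diffWord a b h l (M + 1) =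
      (if (0 + (1 : ℕ) * p) / (M + 1 : ℕ) + 1 = 0 then a else b) ::
        diffWord a b (fun j => (0 + j * p) / (M + 1 : ℕ)) 1 M := fun l hl => by
    have H := fun {j : ℕ} (hj : 0 < j) (hjN : j ≤ M + 1) =>
      eq_rational_of_singular hh hN hN' hdet hp hp' l hl hj hjN
    rw [diffWord_succ, H one_pos (by omega)]
    congr 1
    · congr 2
      ring
    · refine diffWord_congr a b (h l + 1) fun j hj => ?_
      rw [add_assoc, H (by omega) (by omega)]
  have hsplit := diffWord_succ a b (fun j => (0 + j * p) / (M + 1 : ℕ)) 0 M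
  have hnn : (0 : ℝ) ≤ contList (diffWord a b h i' (M + 1)) := Nat.cast_nonneg _
  rcases regular_or_singular hh hN hN' hdet hp hp' i with hi | hi <;>
    rcases regular_or_singular hh hN hN' hdet hp hp' i' with hi' | hi'
  · have : (contList (diffWord a b h i (M + 1)) : ℝ) ≤
        2 * contList (diffWord a b h i' (M + 1)) := by
      exact_mod_cast contList_regular_le ha hb hh hN hN' hdet hp hp' hi hi'
    nlinarith
  · obtain ⟨m, hm⟩ := hreg i hi
    have h₁ := hrat m 0
    rw [hsplit] at h₁
    rw [hm, hsing i' hi']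
    refine h₁.trans ?_
    rw [mul_assoc]
    exact mul_le_mul_of_nonneg_left (contList_change_letter hc
      (letter _ _ (ite_eq_or_eq _ _ _) (ite_eq_or_eq _ _ _)) _ []) zero_le_two
  · obtain ⟨m, hm⟩ := hreg i' hi'
    have h₁ := hrat 0 m
    rw [hsplit] at h₁
    rw [hm, hsing i hi]
    rw [mul_comm 2 c, mul_assoc]
    refine le_trans ?_ (mul_le_mul_of_nonneg_left h₁ (by linarith))
    exact contList_change_letter hc
      (letter _ _ (ite_eq_or_eq _ _ _) (ite_eq_or_eq _ _ _)) _ []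
  · rw [hsing i hi, ← hsing i' hi']
    nlinarith

lemma contList_step_of_lt (ha : 0 < a) (hb : 0 < b) (hc : 1 ≤ c) (hcab : (a : ℝ) ≤ c * b)
    (hcba : (b : ℝ) ≤ c * a) (hh : ∀ j : ℕ, (h j : ℝ) ≤ j * θ + ρ ∧ j * θ + ρ ≤ h j + 1)
    (hNN' : N' ≤ N) (hN' : 0 < N') (hdet : p' * N - p * N' = 1) (hp : (p : ℝ) < N * θ)
    (hp' : N' * θ < p') {r : ℕ} (hr : r < N') {C : ℝ} (hC : c ≤ C)
    (ih : ∀ i i', (contList (diffWord a b h i r) : ℝ) ≤ C * contList (diffWord a b h i' r))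
    (i i' : ℕ) : (contList (diffWord a b h i (N + r)) : ℝ) ≤
      4 * C * contList (diffWord a b h i' (N + r)) := by
  have hN : 0 < N := by omega
  rcases Nat.eq_zero_or_pos r with rfl | hr0
  · refine (contList_window_le ha hb hc hcab hcba hh hN hN' hdet hp hp' i i').trans ?_
    refine mul_le_mul_of_nonneg_right (by linarith) (Nat.cast_nonneg _)
  have split : ∀ l, ∃ u v, h (u + N) = h u + p ∧
      contList (diffWord a b h l (N + r)) ≤
        2 * (contList (diffWord a b h u N) * contList (diffWord a b h v r)) ∧
      contList (diffWord a b h u N) * contList (diffWord a b h v r) ≤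
        contList (diffWord a b h l (N + r)) := by
    intro l
    rcases regular_or_singular hh hN hN' hdet hp hp' l with hl | hl
    · refine ⟨l, l + N, hl, ?_, ?_⟩
      · rw [diffWord_add]
        exact contList_append_le _ _ (diffWord_letters_pos ha hb _ _ _)
          (diffWord_letters_pos ha hb _ _ _)
      · rw [diffWord_add]
        exact contList_mul_le_append _ _
    · refine ⟨l + r, l, regular_of_singular hh hNN' hN' hdet hp hp' l hl hr0 hr, ?_, ?_⟩
      · rw [add_comm N r, diffWord_add, mul_comm (contList _)]
        exact contList_append_le _ _ (diffWord_letters_pos ha hb _ _ _)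
          (diffWord_letters_pos ha hb _ _ _)
      · rw [add_comm N r, diffWord_add, mul_comm (contList _)]
        exact contList_mul_le_append _ _
  obtain ⟨u, v, hu, h₁, -⟩ := split i
  obtain ⟨u', v', hu', -, h₂⟩ := split i'
  have h₃ : (contList (diffWord a b h u N) : ℝ) ≤ 2 * contList (diffWord a b h u' N) := by
    exact_mod_cast contList_regular_le ha hb hh hN hN' hdet hp hp' hu hu'
  have h₁' : (contList (diffWord a b h i (N + r)) : ℝ) ≤
      2 * (contList (diffWord a b h u N) * contList (diffWord a b h v r)) := by exact_mod_cast h₁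
  have h₂' : (contList (diffWord a b h u' N) * contList (diffWord a b h v' r) : ℝ) ≤
      contList (diffWord a b h i' (N + r)) := by exact_mod_cast h₂
  calc (contList (diffWord a b h i (N + r)) : ℝ)
      ≤ 2 * (contList (diffWord a b h u N) * contList (diffWord a b h v r)) := h₁'
    _ ≤ 2 * ((2 * contList (diffWord a b h u' N)) * (C * contList (diffWord a b h v' r))) := by
        gcongr
        exact ih v v'
    _ = 4 * C * (contList (diffWord a b h u' N) * contList (diffWord a b h v' r)) := by ring
    _ ≤ _ := by
        refine mul_le_mul_of_nonneg_left h₂' (by linarith)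

/-- If `p / N` and `p' / N'` are Farey neighbours enclosing `θ` with `N' ≤ N`, then passing from
words of length `r < N'` to words of length `N + r` costs a factor at most `4`. -/
lemma contList_step (ha : 0 < a) (hb : 0 < b) (hc : 1 ≤ c) (hcab : (a : ℝ) ≤ c * b)
    (hcba : (b : ℝ) ≤ c * a) (hh : ∀ j : ℕ, (h j : ℝ) ≤ j * θ + ρ ∧ j * θ + ρ ≤ h j + 1)
    (hNN' : N' ≤ N) (hN' : 0 < N')
    (H : p' * N - p * N' = 1 ∧ (p : ℝ) < N * θ ∧ N' * θ < p' ∨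
      p' * N - p * N' = -1 ∧ N * θ < p ∧ (p' : ℝ) < N' * θ)
    {r : ℕ} (hr : r < N') {C : ℝ} (hC : c ≤ C)
    (ih : ∀ i i', (contList (diffWord a b h i r) : ℝ) ≤ C * contList (diffWord a b h i' r))
    (i i' : ℕ) : (contList (diffWord a b h i (N + r)) : ℝ) ≤
      4 * C * contList (diffWord a b h i' (N + r)) := by
  rcases H with ⟨hdet, hp, hp'⟩ | ⟨hdet, hp, hp'⟩
  · exact contList_step_of_lt ha hb hc hcab hcba hh hNN' hN' hdet hp hp' hr hC ih i i'
  · have := contList_step_of_lt (h := fun j => -h j - 1) (θ := -θ) (ρ := -ρ) (p := -p)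
      (p' := -p') (N := N) (N' := N') (r := r) (C := C) ha hb hc hcab hcba
      (fun j => by
        obtain ⟨h₁, h₂⟩ := hh j
        push_cast
        constructor <;> linarith)
      hNN' hN' (by linarith) (by push_cast; linarith) (by push_cast; linarith) hr hC
      (by simpa only [diffWord_neg] using ih) i i'
    simpa only [diffWord_neg] using this

end Farey

section Convergents

variable {d : ℕ → ℕ}

lemma cfQ_pos (d : ℕ → ℕ) : ∀ k, 0 < cfQ d k
  | 0 => by simp [cfQ]
  | 1 => by simp only [cfQ]; omega
  | k + 2 => by
    have := cfQ_pos d k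
    simp only [cfQ]
    omega

lemma cfQ_le_succ (hd : ∀ k, 1 ≤ k → 1 ≤ d k) : ∀ k, cfQ d k ≤ cfQ d (k + 1)
  | 0 => by simp only [cfQ]; omega
  | k + 1 => by
    have := hd (k + 2) (by omega)
    simp only [cfQ]
    nlinarith [Nat.zero_le (cfQ d (k + 1))]

lemma cf_det (d : ℕ → ℕ) : ∀ k,
    (cfP d (k + 1) : ℤ) * cfQ d k - cfP d k * cfQ d (k + 1) = (-1) ^ k
  | 0 => by simp [cfP, cfQ]
  | k + 1 => by
    have := cf_det d k
    simp only [cfP, cfQ] at this ⊢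
    push_cast
    rw [pow_succ]
    linear_combination -this

/-- Second differences of the convergents, as a cross-multiplied determinant. -/
lemma cf_det_two (d : ℕ → ℕ) (k : ℕ) :
    (cfP d (k + 2) : ℤ) * cfQ d k - cfP d k * cfQ d (k + 2) = (-1) ^ k * d (k + 2) := by
  have := cf_det d k
  simp only [cfP, cfQ]
  push_cast
  linear_combination (d (k + 2) : ℤ) * this

lemma cf_lt_of_tendsto {θ : ℝ} (hθ : Irrational θ)
    (hθd : Tendsto (fun k => (cfP d k : ℝ) / (cfQ d k : ℝ)) atTop (nhds θ)) (k : ℕ) :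
    (Even k → (cfP d k : ℝ) < cfQ d k * θ) ∧ (Odd k → cfQ d k * θ < cfP d k) := by
  have hQ : ∀ k, (0 : ℝ) < cfQ d k := fun k => by exact_mod_cast cfQ_pos d k
  have hdet : ∀ k, (cfP d (k + 2) : ℝ) * cfQ d k - cfP d k * cfQ d (k + 2) =
      (-1) ^ k * d (k + 2) := fun k => by exact_mod_cast cf_det_two d k
  have hne : ∀ k, (cfP d k : ℝ) / cfQ d k ≠ θ := fun k h =>
    hθ ⟨(cfP d k : ℚ) / cfQ d k, by push_cast; exact h⟩
  have ht : Tendsto (fun j => k + 2 * j) atTop atTop :=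
    tendsto_atTop_mono (fun j => show j ≤ k + 2 * j by omega) tendsto_id
  have hlim := hθd.comp ht
  constructor
  · intro hk
    have hmono : Monotone ((fun k => (cfP d k : ℝ) / (cfQ d k : ℝ)) ∘ fun j => k + 2 * j) := by
      refine monotone_nat_of_le_succ fun j => ?_
      have e : k + 2 * (j + 1) = (k + 2 * j) + 2 := by ring
      have hev : Even (k + 2 * j) := hk.add (even_two_mul j)
      have := hdet (k + 2 * j)
      rw [hev.neg_one_pow] at this
      simp only [Function.comp, e]
      rw [div_le_div_iff₀ (hQ _) (hQ _)]
      have h0 : (0 : ℝ) ≤ d (k + 2 * j + 2) := Nat.cast_nonneg _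
      linarith
    have hle := hmono.ge_of_tendsto hlim 0
    have hlt := lt_of_le_of_ne hle (hne _)
    simp only [Function.comp, mul_zero, add_zero] at hlt
    rw [div_lt_iff₀ (hQ k)] at hlt
    linarith
  · intro hk
    have hanti : Antitone ((fun k => (cfP d k : ℝ) / (cfQ d k : ℝ)) ∘ fun j => k + 2 * j) := by
      refine antitone_nat_of_succ_le fun j => ?_
      have e : k + 2 * (j + 1) = (k + 2 * j) + 2 := by ring
      have hodd : Odd (k + 2 * j) := hk.add_even (even_two_mul j)
      have := hdet (k + 2 * j)
      rw [hodd.neg_one_pow] at this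
      simp only [Function.comp, e]
      rw [div_le_div_iff₀ (hQ _) (hQ _)]
      have h0 : (0 : ℝ) ≤ d (k + 2 * j + 2) := Nat.cast_nonneg _
      linarith
    have hle := hanti.le_of_tendsto hlim 0
    have hlt := lt_of_le_of_ne hle (hne _).symm
    simp only [Function.comp, mul_zero, add_zero] at hlt
    rw [lt_div_iff₀ (hQ k)] at hlt
    linarith

end Convergents

lemma contList_diffWord_le_pow {a b : ℕ} (ha : 0 < a) (hb : 0 < b) {c : ℝ} (hc : 1 ≤ c)
    (hcab : (a : ℝ) ≤ c * b) (hcba : (b : ℝ) ≤ c * a) {d : ℕ → ℕ} (hd : ∀ k, 1 ≤ k → 1 ≤ d k)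
    {θ ρ : ℝ} (hθ : Irrational θ)
    (hθd : Tendsto (fun k => (cfP d k : ℝ) / (cfQ d k : ℝ)) atTop (nhds θ)) {h : ℕ → ℤ}
    (hh : ∀ j : ℕ, (h j : ℝ) ≤ j * θ + ρ ∧ j * θ + ρ ≤ h j + 1) (k : ℕ) :
    ∀ n < cfQ d (k + 1), ∀ i i', (contList (diffWord a b h i n) : ℝ) ≤
      4 ^ k * c * contList (diffWord a b h i' n) := by
  have hsign := cf_lt_of_tendsto hθ hθd
  induction k with
  | zero =>
    intro n hn i i'
    have hθ0 : 0 < θ := by simpa [cfP, cfQ] using (hsign 0).1 Even.zero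
    have hθ1 : (1 + d 1) * θ < 1 := by simpa [cfP, cfQ] using (hsign 1).2 odd_one
    have hm : ∀ j, h j ≤ h (j + 1) := fun j => by
      obtain ⟨h₁, h₂⟩ := hh j
      obtain ⟨h₃, h₄⟩ := hh (j + 1)
      push_cast at h₃ h₄
      have : (h j : ℝ) < h (j + 1) + 1 := by linarith
      have : h j < h (j + 1) + 1 := by exact_mod_cast this
      omega
    have hle : ∀ l, h (l + n) ≤ h l + 1 := fun l => by
      obtain ⟨h₁, h₂⟩ := hh l
      obtain ⟨h₃, h₄⟩ := hh (l + n)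
      push_cast at h₃ h₄
      have hn' : (n : ℝ) ≤ 1 + d 1 := by
        have : n ≤ 1 + d 1 := by simpa [cfQ] using hn.le
        exact_mod_cast this
      have : (h (l + n) : ℝ) < h l + 2 := by nlinarith
      have : h (l + n) < h l + 2 := by exact_mod_cast this
      omega
    simpa using contList_diffWord_le_of_le_one hm hc hcab hcba (hle i) (hle i')
  | succ k ih =>
    intro n hn i i'
    have hpow : (1 : ℝ) ≤ 4 ^ k := one_le_pow₀ (by norm_num)
    have hcC : c ≤ 4 ^ k * c := by nlinarith
    have hrw : (4 : ℝ) ^ (k + 1) * c = 4 * (4 ^ k * c) := by ring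
    rw [hrw]
    rcases lt_or_ge n (cfQ d (k + 1)) with hlt | hge
    · refine (ih n hlt i i').trans ?_
      refine mul_le_mul_of_nonneg_right (by linarith) (Nat.cast_nonneg _)
    have hQ := cfQ_le_succ hd k
    have hQ0 := cfQ_pos d k
    have hQ1 := cfQ_pos d (k + 1)
    have hdet := cf_det d k
    rcases lt_or_ge n (cfQ d (k + 1) + cfQ d k) with hlt | hge'
    · obtain ⟨r, rfl⟩ : ∃ r, n = cfQ d (k + 1) + r := ⟨n - cfQ d (k + 1), by omega⟩
      refine contList_step (p := cfP d (k + 1)) (p' := cfP d k) ha hb hc hcab hcba hh hQ hQ0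
        ?_ (by omega : r < cfQ d k) hcC (ih r (by omega)) i i'
      rcases Nat.even_or_odd k with hk | hk
      · rw [hk.neg_one_pow] at hdet
        exact Or.inr ⟨by linarith, by exact_mod_cast (hsign (k + 1)).2 hk.add_one,
          by exact_mod_cast (hsign k).1 hk⟩
      · rw [hk.neg_one_pow] at hdet
        exact Or.inl ⟨by linarith, by exact_mod_cast (hsign (k + 1)).1 hk.add_one,
          by exact_mod_cast (hsign k).2 hk⟩
    · obtain ⟨t, r, hr, hn'⟩ : ∃ t r, r < cfQ d (k + 1) ∧
          n = t * cfQ d (k + 1) + cfQ d k + r := by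
        refine ⟨(n - cfQ d k) / cfQ d (k + 1), (n - cfQ d k) % cfQ d (k + 1),
          Nat.mod_lt _ hQ1, ?_⟩
        have := Nat.div_add_mod' (n - cfQ d k) (cfQ d (k + 1))
        omega
      subst hn'
      have ht1 : 1 ≤ t := by
        by_contra! hcon
        have : t = 0 := by omega
        subst this
        omega
      have htd : t ≤ d (k + 2) := by
        by_contra! hcon
        simp only [cfQ] at hn
        nlinarith [Nat.mul_le_mul_right (cfQ d (k + 1)) hcon.le]
      have htdR : (t : ℝ) ≤ d (k + 2) := by exact_mod_cast htd
      refine contList_step (N := t * cfQ d (k + 1) + cfQ d k) (N' := cfQ d (k + 1))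
        (p := t * cfP d (k + 1) + cfP d k) (p' := cfP d (k + 1)) ha hb hc hcab hcba hh
        (by nlinarith) hQ1 ?_ hr hcC (ih r hr) i i'
      rcases Nat.even_or_odd k with hk | hk
      · rw [hk.neg_one_pow] at hdet
        have s₁ := (hsign (k + 1)).2 hk.add_one
        have s₂ := (hsign (k + 2)).1 (hk.add even_two)
        simp only [cfP, cfQ] at s₂
        push_cast at s₂
        refine Or.inl ⟨by push_cast; linarith, ?_, by exact_mod_cast s₁⟩
        push_cast
        nlinarith
      · rw [hk.neg_one_pow] at hdet
        have s₁ := (hsign (k + 1)).1 hk.add_one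
        have s₂ := (hsign (k + 2)).2 (hk.add_even even_two)
        simp only [cfP, cfQ] at s₂
        push_cast at s₂
        refine Or.inr ⟨by push_cast; linarith, ?_, by exact_mod_cast s₁⟩
        push_cast
        nlinarith

lemma exists_floor_of_mechWord {a b : ℕ} {θ ρ : ℝ} {s : ℕ → ℕ}
    (hs : s = mechWord a b θ ρ ∨ s = mechWord' a b θ ρ) :
    ∃ (σ : ℝ) (h : ℕ → ℤ), (∀ j : ℕ, (h j : ℝ) ≤ j * θ + σ ∧ j * θ + σ ≤ h j + 1) ∧
      ∀ j, s (j + 1) = if h (j + 1) - h j = 0 then a else b := by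
  rcases hs with rfl | rfl
  · refine ⟨ρ, fun j => ⌊(j : ℝ) * θ + ρ⌋, fun j => ⟨Int.floor_le _, (Int.lt_floor_add_one _).le⟩,
      fun j => ?_⟩
    simp [mechWord]
  · refine ⟨ρ + 1, fun j => ⌈(j : ℝ) * θ + ρ⌉, fun j => ⟨?_, ?_⟩, fun j => ?_⟩
    · have := Int.ceil_lt_add_one ((j : ℝ) * θ + ρ)
      linarith
    · have := Int.le_ceil ((j : ℝ) * θ + ρ)
      linarith
    · simp [mechWord']

/-- Proposition `prop1`. Let `s` be a Sturmian word over `{a,b}` and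
`c = max (b/a) (a/b)`.  For any factors `M`, `M'` of `s` of the same length `n` with
`q_k ≤ n ≤ q_{k+1} - 1`, one has `K(M) ≤ 2^(2k) · c · K(M')`. -/
theorem stmt5 (a b : ℕ) (ha : 0 < a) (hb : 0 < b) (hab : a ≠ b)
    (d : ℕ → ℕ) (hd : ∀ k, 1 ≤ k → 1 ≤ d k)
    (θ ρ : ℝ) (hθ : Irrational θ) (hρ : ρ ∈ Set.Ico (0 : ℝ) 1)
    (hθd : Tendsto (fun k => (cfP d k : ℝ) / (cfQ d k : ℝ)) atTop (nhds θ))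
    (s : ℕ → ℕ) (hs : s = mechWord a b θ ρ ∨ s = mechWord' a b θ ρ)
    (k n : ℕ) (h1 : cfQ d k ≤ n) (h2 : n ≤ cfQ d (k + 1) - 1)
    (M M' : List ℕ) (hM : IsFactorSeq s M) (hM' : IsFactorSeq s M')
    (hMl : M.length = n) (hM'l : M'.length = n) :
    (contList M : ℝ) ≤ 2 ^ (2 * k) * max ((b : ℝ) / a) ((a : ℝ) / b) * contList M' := by
  obtain ⟨σ, h, hh, hsh⟩ := exists_floor_of_mechWord hs
  have haR : (0 : ℝ) < a := by exact_mod_cast ha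
  have hbR : (0 : ℝ) < b := by exact_mod_cast hb
  have hword : ∀ L : List ℕ, IsFactorSeq s L → L.length = n →
      ∃ i, L = diffWord a b h i n := by
    rintro L ⟨i, hi⟩ hL
    refine ⟨i, ?_⟩
    rw [hi, hL]
    exact List.map_congr_left fun j _ => hsh (i + j)
  obtain ⟨i, rfl⟩ := hword M hM hMl
  obtain ⟨i', rfl⟩ := hword M' hM' hM'l
  have hcba : (b : ℝ) ≤ max ((b : ℝ) / a) ((a : ℝ) / b) * a :=
    (div_le_iff₀ haR).1 (le_max_left _ _)
  have hcab : (a : ℝ) ≤ max ((b : ℝ) / a) ((a : ℝ) / b) * b :=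
    (div_le_iff₀ hbR).1 (le_max_right _ _)
  have hc : 1 ≤ max ((b : ℝ) / a) ((a : ℝ) / b) := by
    rcases le_total (a : ℝ) b with hle | hle
    · exact le_max_of_le_left ((one_le_div haR).2 hle)
    · exact le_max_of_le_right ((one_le_div hbR).2 hle)
  rw [pow_mul, show (2 : ℝ) ^ 2 = 4 by norm_num]
  have := cfQ_pos d (k + 1)
  exact contList_diffWord_le_pow ha hb hc hcab hcba hd hθ hθd hh k n (by omega) i i'
end

section
/- Let α = [0; s_1, s_2, ...] be the real number whose sequence of partial quotients is a Sturmian word s = s_1 s_2 ... over {a,b}. Then α has a Lévy constant, i.e., the limit L(α) = lim_{n→∞} (1/n) log Q_n(α) exists; moreover this limit depends only on the slope of s and not on its intercept. -/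
open Filter Real Matrix

/-- A rounding function: a monotone map `ℝ → ℤ` at distance at most one from the identity and
commuting with integer translations, such as the floor and the ceiling. -/
structure IsRounding (F : ℝ → ℤ) : Prop where
  mono : Monotone F
  add_int : ∀ (x : ℝ) (z : ℤ), F (x + z) = F x + z
  abs_sub_le : ∀ x : ℝ, |(F x : ℝ) - x| ≤ 1

lemma isRounding_floor : IsRounding (fun x : ℝ => ⌊x⌋) where
  mono := Int.floor_mono
  add_int := Int.floor_add_intCast
  abs_sub_le x := by
    rw [abs_le]
    constructor <;> linarith [Int.floor_le x, Int.lt_floor_add_one x]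

lemma isRounding_ceil : IsRounding (fun x : ℝ => ⌈x⌉) where
  mono := Int.ceil_mono
  add_int := Int.ceil_add_intCast
  abs_sub_le x := by
    rw [abs_le]
    constructor <;> linarith [Int.le_ceil x, Int.ceil_lt_add_one x]

/-- The word coding the rotation orbit `x, x + θ, x + 2θ, …` through the rounding `F`. -/
def rotWord (F : ℝ → ℤ) (a b : ℕ) (θ x : ℝ) (n : ℕ) : ℕ :=
  if F (x + n * θ) - F (x + ((n : ℝ) - 1) * θ) = 0 then a else b

lemma mechWord_eq_rotWord (a b : ℕ) (θ ρ : ℝ) :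
    mechWord a b θ ρ = rotWord (fun x => ⌊x⌋) a b θ ρ := by
  funext n
  simp only [mechWord, rotWord, add_comm]

lemma mechWord'_eq_rotWord (a b : ℕ) (θ ρ : ℝ) :
    mechWord' a b θ ρ = rotWord (fun x => ⌈x⌉) a b θ ρ := by
  funext n
  simp only [mechWord', rotWord, add_comm]

lemma rotWord_add (F : ℝ → ℤ) (a b : ℕ) (θ x : ℝ) (m n : ℕ) :
    rotWord F a b θ x (m + n) = rotWord F a b θ (x + m * θ) n := by
  have h₁ : x + ((m + n : ℕ) : ℝ) * θ = x + m * θ + n * θ := by push_cast; ring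
  have h₂ : x + (((m + n : ℕ) : ℝ) - 1) * θ = x + m * θ + ((n : ℝ) - 1) * θ := by
    push_cast; ring
  simp only [rotWord, h₁, h₂]

lemma rotWord_pos {a b : ℕ} (ha : 0 < a) (hb : 0 < b) (F : ℝ → ℤ) (θ x : ℝ) (n : ℕ) :
    0 < rotWord F a b θ x n := by
  unfold rotWord
  split_ifs <;> assumption

/-- The Birkhoff sums of `f` along the rotation by `θ` are linear up to a uniform error. -/
def HasBoundedRemainder (θ : ℝ) (f : ℝ → ℝ) : Prop :=
  ∃ C B : ℝ, ∀ (x : ℝ) (n : ℕ), |∑ i ∈ Finset.range n, f (x + i * θ) - n * C| ≤ B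

namespace HasBoundedRemainder

variable {θ : ℝ} {f g : ℝ → ℝ}

lemma const (c : ℝ) : HasBoundedRemainder θ (fun _ => c) :=
  ⟨c, 0, fun x n => by simp⟩

lemma add (hf : HasBoundedRemainder θ f) (hg : HasBoundedRemainder θ g) :
    HasBoundedRemainder θ (f + g) := by
  obtain ⟨C, B, hB⟩ := hf
  obtain ⟨C', B', hB'⟩ := hg
  refine ⟨C + C', B + B', fun x n => ?_⟩
  have h := abs_add_le (∑ i ∈ Finset.range n, f (x + i * θ) - n * C)
    (∑ i ∈ Finset.range n, g (x + i * θ) - n * C')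
  have e : ∑ i ∈ Finset.range n, (f + g) (x + i * θ) - n * (C + C') =
      (∑ i ∈ Finset.range n, f (x + i * θ) - n * C) +
        (∑ i ∈ Finset.range n, g (x + i * θ) - n * C') := by
    simp only [Pi.add_apply, Finset.sum_add_distrib]; ring
  rw [e]
  linarith [hB x n, hB' x n]

lemma smul (c : ℝ) (hf : HasBoundedRemainder θ f) : HasBoundedRemainder θ (c • f) := by
  obtain ⟨C, B, hB⟩ := hf
  refine ⟨c * C, |c| * B, fun x n => ?_⟩
  have e : ∑ i ∈ Finset.range n, (c • f) (x + i * θ) - n * (c * C) =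
      c * (∑ i ∈ Finset.range n, f (x + i * θ) - n * C) := by
    simp only [Pi.smul_apply, smul_eq_mul, ← Finset.mul_sum]; ring
  rw [e, abs_mul]
  exact mul_le_mul_of_nonneg_left (hB x n) (abs_nonneg c)

lemma shift (t : ℝ) (hf : HasBoundedRemainder θ f) :
    HasBoundedRemainder θ (fun x => f (x + t)) := by
  obtain ⟨C, B, hB⟩ := hf
  refine ⟨C, B, fun x n => ?_⟩
  simpa only [add_right_comm] using hB (x + t) n

lemma exists_bound (hf : HasBoundedRemainder θ f) : ∃ A : ℝ, ∀ x, |f x| ≤ A := by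
  obtain ⟨C, B, hB⟩ := hf
  refine ⟨B + |C|, fun x => ?_⟩
  have h := hB x 1
  simp only [Finset.range_one, Finset.sum_singleton, Nat.cast_zero, zero_mul, add_zero,
    Nat.cast_one, one_mul] at h
  linarith [abs_sub_abs_le_abs_sub (f x) C]

end HasBoundedRemainder

/-- The function `x ↦ F (x + {jθ}) - F x`. -/
noncomputable def stepFun (F : ℝ → ℤ) (θ : ℝ) (j : ℕ) (x : ℝ) : ℝ :=
  F (x + Int.fract (j * θ)) - F x

/-- The algebra generated by the functions `stepFun F θ j`. -/
def stepAlgebra (F : ℝ → ℤ) (θ : ℝ) : Subalgebra ℝ (ℝ → ℝ) :=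
  Algebra.adjoin ℝ (Set.range (stepFun F θ))

namespace IsRounding

variable {F : ℝ → ℤ}

lemma apply_add_eq_or (hF : IsRounding F) {t : ℝ} (h₀ : 0 ≤ t) (h₁ : t ≤ 1) (x : ℝ) :
    F (x + t) = F x ∨ F (x + t) = F x + 1 := by
  have h := hF.mono (show x ≤ x + t by linarith)
  have h' := hF.mono (show x + t ≤ x + (1 : ℤ) by push_cast; linarith)
  rw [hF.add_int] at h'
  lia

lemma apply_add_nat_mul (hF : IsRounding F) (θ : ℝ) (j : ℕ) (x : ℝ) :
    (F (x + j * θ) : ℝ) = stepFun F θ j x + F x + ⌊j * θ⌋ := by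
  have e : x + j * θ = x + Int.fract (j * θ) + (⌊j * θ⌋ : ℤ) := by
    rw [add_assoc, Int.fract_add_floor]
  unfold stepFun
  rw [e, hF.add_int]
  push_cast
  ring

lemma stepFun_mul_of_le (hF : IsRounding F) {θ : ℝ} {j k : ℕ}
    (h : Int.fract (j * θ) ≤ Int.fract (k * θ)) :
    stepFun F θ j * stepFun F θ k = stepFun F θ j := by
  funext x
  have hm := hF.mono (add_le_add_right h x)
  have hj := hF.apply_add_eq_or (Int.fract_nonneg (j * θ)) (Int.fract_lt_one (j * θ)).le x
  have hk := hF.apply_add_eq_or (Int.fract_nonneg (k * θ)) (Int.fract_lt_one (k * θ)).le x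
  simp only [Pi.mul_apply, stepFun]
  rcases hj with hj | hj
  · simp [hj]
  · have hk' : F (x + Int.fract (k * θ)) = F x + 1 := by lia
    simp [hj, hk']

lemma stepFun_mul (hF : IsRounding F) (θ : ℝ) (j k : ℕ) :
    stepFun F θ j * stepFun F θ k ∈ Set.range (stepFun F θ) := by
  rcases le_total (Int.fract (j * θ)) (Int.fract (k * θ)) with h | h
  · exact ⟨j, (hF.stepFun_mul_of_le h).symm⟩
  · exact ⟨k, by rw [mul_comm, hF.stepFun_mul_of_le h]⟩

lemma hasBoundedRemainder_diff (hF : IsRounding F) (θ : ℝ) :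
    HasBoundedRemainder θ (fun x => (F (x + θ) : ℝ) - F x) := by
  refine ⟨θ, 2, fun x n => ?_⟩
  have e : ∑ i ∈ Finset.range n, ((F (x + i * θ + θ) : ℝ) - F (x + i * θ)) =
      F (x + n * θ) - F x := by
    have h := Finset.sum_range_sub (fun i : ℕ => (F (x + i * θ) : ℝ)) n
    simp only [Nat.cast_zero, zero_mul, add_zero] at h
    rw [← h]
    refine Finset.sum_congr rfl fun i _ => ?_
    rw [show x + ((i + 1 : ℕ) : ℝ) * θ = x + i * θ + θ by push_cast; ring]
  rw [e]
  have h₁ := abs_le.1 (hF.abs_sub_le (x + n * θ))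
  have h₂ := abs_le.1 (hF.abs_sub_le x)
  rw [abs_le]
  constructor <;> linarith [h₁.1, h₁.2, h₂.1, h₂.2]

lemma hasBoundedRemainder_nat_diff (hF : IsRounding F) (θ : ℝ) (j : ℕ) :
    HasBoundedRemainder θ (fun x => (F (x + j * θ) : ℝ) - F x) := by
  induction j with
  | zero => simpa using HasBoundedRemainder.const (θ := θ) 0
  | succ j ih =>
    convert ih.add ((hF.hasBoundedRemainder_diff θ).shift (j * θ)) using 1
    funext x
    rw [Pi.add_apply, show x + ((j + 1 : ℕ) : ℝ) * θ = x + j * θ + θ by push_cast; ring]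
    ring

lemma hasBoundedRemainder_stepFun (hF : IsRounding F) (θ : ℝ) (j : ℕ) :
    HasBoundedRemainder θ (stepFun F θ j) := by
  convert (hF.hasBoundedRemainder_nat_diff θ j).add
    (HasBoundedRemainder.const (-(⌊j * θ⌋ : ℝ))) using 1
  funext x
  rw [Pi.add_apply, hF.apply_add_nat_mul]
  ring

lemma hasBoundedRemainder_of_mem (hF : IsRounding F) {θ : ℝ} {f : ℝ → ℝ}
    (hf : f ∈ stepAlgebra F θ) : HasBoundedRemainder θ f := by
  rw [stepAlgebra, ← Subalgebra.mem_toSubmodule, Algebra.adjoin_eq_span] at hf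
  induction hf using Submodule.span_induction with
  | mem f hf =>
    have h : f = 1 ∨ f ∈ Set.range (stepFun F θ) := by
      induction hf using Submonoid.closure_induction with
      | mem f hf => exact Or.inr hf
      | one => exact Or.inl rfl
      | mul f g _ _ hf hg =>
        rcases hf with rfl | ⟨j, rfl⟩
        · simpa using hg
        · rcases hg with rfl | ⟨k, rfl⟩
          · simp
          · exact Or.inr (hF.stepFun_mul θ j k)
    rcases h with rfl | ⟨j, rfl⟩
    · exact HasBoundedRemainder.const 1
    · exact hF.hasBoundedRemainder_stepFun θ j
  | zero => exact HasBoundedRemainder.const 0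
  | add f g _ _ hf hg => exact hf.add hg
  | smul c f _ hf => exact hf.smul c

lemma diff_mem_stepAlgebra (hF : IsRounding F) (θ : ℝ) (n : ℕ) :
    (fun x => (F (x + (n + 1 : ℕ) * θ) : ℝ) - F (x + n * θ)) ∈ stepAlgebra F θ := by
  have hs : ∀ j, stepFun F θ j ∈ stepAlgebra F θ := fun j => Algebra.subset_adjoin ⟨j, rfl⟩
  convert add_mem (sub_mem (hs (n + 1)) (hs n))
    ((stepAlgebra F θ).algebraMap_mem ((⌊(n + 1 : ℕ) * θ⌋ : ℝ) - ⌊n * θ⌋)) using 1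
  funext x
  simp only [hF.apply_add_nat_mul, Pi.add_apply, Pi.sub_apply, Pi.algebraMap_apply,
    Algebra.algebraMap_self, RingHom.id_apply]
  ring

/-- If the two functions obtained by freezing a letter of the word lie in `stepAlgebra F θ`, so
does the function which reads that letter. -/
lemma comp_rotWord_mem (hF : IsRounding F) {a b : ℕ} {θ : ℝ} (hθ : θ ∈ Set.Icc (0 : ℝ) 1)
    (n : ℕ) (H : ℕ → ℝ → ℝ) (hH : ∀ c, H c ∈ stepAlgebra F θ) :
    (fun x => H (rotWord F a b θ x (n + 1)) x) ∈ stepAlgebra F θ := by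
  have hd := hF.diff_mem_stepAlgebra θ n
  convert add_mem (mul_mem (sub_mem (one_mem _) hd) (hH a)) (mul_mem hd (hH b)) using 1
  funext x
  have h := hF.apply_add_eq_or hθ.1 hθ.2 (x + n * θ)
  rw [show x + n * θ + θ = x + (n + 1 : ℕ) * θ by push_cast; ring] at h
  have e : x + (((n + 1 : ℕ) : ℝ) - 1) * θ = x + n * θ := by push_cast; ring
  simp only [rotWord, e, Pi.add_apply, Pi.mul_apply, Pi.sub_apply, Pi.one_apply]
  rcases h with h | h <;> rw [h] <;> simp

lemma comp_contQ_mem (hF : IsRounding F) (a b : ℕ) {θ : ℝ} (hθ : θ ∈ Set.Icc (0 : ℝ) 1)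
    (n : ℕ) (G : ℕ → ℕ → ℝ) :
    (fun x => G (contQ (rotWord F a b θ x) n) (contQ (rotWord F a b θ x) (n + 1))) ∈
      stepAlgebra F θ := by
  induction n generalizing G with
  | zero =>
    simpa [contQ] using hF.comp_rotWord_mem (a := a) (b := b) hθ 0 (fun c _ => G 1 c)
      fun c => (stepAlgebra F θ).algebraMap_mem (G 1 c)
  | succ n ih =>
    exact hF.comp_rotWord_mem (a := a) (b := b) hθ (n + 1)
      (fun c x => G (contQ (rotWord F a b θ x) (n + 1))
        (c * contQ (rotWord F a b θ x) (n + 1) + contQ (rotWord F a b θ x) n))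
      fun c => ih fun p q => G q (c * q + p)

lemma hasBoundedRemainder_log_contQ (hF : IsRounding F) (a b : ℕ) {θ : ℝ}
    (hθ : θ ∈ Set.Icc (0 : ℝ) 1) (n : ℕ) :
    HasBoundedRemainder θ (fun x => Real.log (contQ (rotWord F a b θ x) n)) :=
  hF.hasBoundedRemainder_of_mem (hF.comp_contQ_mem a b hθ n fun p _ => Real.log p)

end IsRounding

lemma contQ_pos {w : ℕ → ℕ} (hw : ∀ n, 0 < w n) : ∀ n, 0 < contQ w n
  | 0 => Nat.one_pos
  | 1 => hw 1
  | n + 2 => by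
    rw [contQ]
    exact Nat.add_pos_right _ (contQ_pos hw n)

lemma contQ_le_succ {w : ℕ → ℕ} (hw : ∀ n, 0 < w n) : ∀ n, contQ w n ≤ contQ w (n + 1)
  | 0 => hw 1
  | n + 1 => by
    rw [contQ]
    nlinarith [hw (n + 2), Nat.zero_le (contQ w (n + 1))]

lemma contQ_mul_le {w v : ℕ → ℕ} {m : ℕ} (hv : ∀ n, w (m + n) = v n) :
    ∀ n, contQ w m * contQ v n ≤ contQ w (m + n)
  | 0 => by simp [contQ]
  | 1 => by
    cases m with
    | zero => simp [contQ, ← hv]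
    | succ m =>
      simp only [contQ, ← hv]
      nlinarith [Nat.zero_le (contQ w m)]
  | n + 2 => by
    have h₀ := contQ_mul_le hv n
    have h₁ := Nat.mul_le_mul_left (v (n + 2)) (contQ_mul_le hv (n + 1))
    have e : contQ w (m + (n + 2)) = v (n + 2) * contQ w (m + (n + 1)) + contQ w (m + n) := by
      rw [← hv]; rfl
    rw [e, contQ]
    linarith

lemma contQ_add_le {w v : ℕ → ℕ} {m : ℕ} (hw : ∀ n, 0 < w n) (hv : ∀ n, w (m + n) = v n) :
    ∀ n, contQ w (m + n) ≤ 2 * (contQ w m * contQ v n)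
  | 0 => by simp only [contQ, add_zero]; lia
  | 1 => by
    cases m with
    | zero => simp only [contQ, ← hv, zero_add]; lia
    | succ m =>
      have h := contQ_le_succ hw m
      have h' := Nat.mul_le_mul_right (contQ w (m + 1)) (hw (m + 1 + 1))
      simp only [contQ, ← hv]
      linarith
  | n + 2 => by
    have h₀ := contQ_add_le hw hv n
    have h₁ := Nat.mul_le_mul_left (v (n + 2)) (contQ_add_le hw hv (n + 1))
    have e : contQ w (m + (n + 2)) = v (n + 2) * contQ w (m + (n + 1)) + contQ w (m + n) := by
      rw [← hv]; rfl
    rw [e, contQ]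
    linarith

lemma abs_log_contQ_add_sub_le {w v : ℕ → ℕ} {m : ℕ} (hw : ∀ n, 0 < w n)
    (hv : ∀ n, w (m + n) = v n) (n : ℕ) :
    |Real.log (contQ w (m + n)) - Real.log (contQ w m) - Real.log (contQ v n)| ≤
      Real.log 2 := by
  have hp : (0 : ℝ) < contQ w m := by exact_mod_cast contQ_pos hw m
  have hq : (0 : ℝ) < contQ v n := by
    exact_mod_cast contQ_pos (fun n => hv n ▸ hw (m + n)) n
  have hr : (0 : ℝ) < contQ w (m + n) := by exact_mod_cast contQ_pos hw (m + n)
  have h₁ : (contQ w m : ℝ) * contQ v n ≤ contQ w (m + n) := by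
    exact_mod_cast contQ_mul_le hv n
  have h₂ : (contQ w (m + n) : ℝ) ≤ 2 * (contQ w m * contQ v n) := by
    exact_mod_cast contQ_add_le hw hv n
  have h₁' := Real.log_le_log (by positivity) h₁
  have h₂' := Real.log_le_log hr h₂
  rw [Real.log_mul (by positivity) (by positivity), Real.log_mul hp.ne' hq.ne'] at h₂'
  rw [Real.log_mul hp.ne' hq.ne'] at h₁'
  rw [abs_le]
  constructor <;> linarith [Real.log_nonneg (one_le_two : (1 : ℝ) ≤ 2)]

/-- A function `g n x` which is additive along the rotation by `θ` up to a bounded error, and for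
which every `g n` has bounded remainder, has a uniform growth rate up to `2 * K / m`. -/
lemma abs_sub_le_of_almost_additive {θ K : ℝ} {g : ℕ → ℝ → ℝ}
    (hg : ∀ m n x, |g (m + n) x - g m x - g n (x + m * θ)| ≤ K)
    (hr : ∀ n, HasBoundedRemainder θ (g n)) (m : ℕ) :
    ∃ C B : ℝ, ∀ n x, |m * g n x - n * C| ≤ n * K + B := by
  obtain ⟨C, B, hB⟩ := hr m
  choose A hA using fun n => (hr n).exists_bound
  refine ⟨C, B + ∑ j ∈ Finset.range m, (K + 2 * A j), fun n x => ?_⟩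
  have tele : ∑ i ∈ Finset.range n, (g (i + m) x - g i x) =
      ∑ j ∈ Finset.range m, (g (n + j) x - g j x) := by
    have h₁ := Finset.sum_range_add (fun i => g i x) n m
    have h₂ := Finset.sum_range_add (fun i => g i x) m n
    rw [add_comm m n] at h₂
    simp only [Finset.sum_sub_distrib, add_comm _ m]
    linarith
  have h₁ : |∑ i ∈ Finset.range n, (g (i + m) x - g i x - g m (x + i * θ))| ≤ n * K := by
    refine (Finset.abs_sum_le_sum_abs _ _).trans ?_
    refine (Finset.sum_le_sum fun i _ => hg i m x).trans ?_
    simp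
  have h₂ : |∑ j ∈ Finset.range m, (g (n + j) x - g j x - g n x)| ≤
      ∑ j ∈ Finset.range m, (K + 2 * A j) := by
    refine (Finset.abs_sum_le_sum_abs _ _).trans (Finset.sum_le_sum fun j _ => ?_)
    have ha := abs_le.1 (hg n j x)
    have hb := abs_le.1 (hA j x)
    have hc := abs_le.1 (hA j (x + n * θ))
    rw [abs_le]
    constructor <;> linarith [ha.1, ha.2, hb.1, hb.2, hc.1, hc.2]
  rw [Finset.sum_sub_distrib, tele] at h₁
  rw [Finset.sum_sub_distrib, Finset.sum_const, Finset.card_range, nsmul_eq_mul] at h₂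
  have h₁' := abs_le.1 h₁
  have h₂' := abs_le.1 h₂
  have h₃ := abs_le.1 (hB x n)
  rw [abs_le]
  constructor <;> linarith [h₁'.1, h₁'.2, h₂'.1, h₂'.2, h₃.1, h₃.2]

lemma exists_forall_tendsto_of_uniform {ι : Type*} [Nonempty ι] {u : ι → ℕ → ℝ}
    (h : ∀ ε > 0, ∃ (c : ℝ) (N : ℕ), ∀ i, ∀ n ≥ N, |u i n - c| ≤ ε) :
    ∃ ℓ : ℝ, ∀ i, Tendsto (u i) atTop (nhds ℓ) := by
  obtain ⟨i₀⟩ := ‹Nonempty ι›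
  have hc : CauchySeq (u i₀) := by
    rw [Metric.cauchySeq_iff']
    intro ε hε
    obtain ⟨c, N, hN⟩ := h (ε / 3) (by positivity)
    refine ⟨N, fun n hn => ?_⟩
    have h₁ := abs_le.1 (hN i₀ n hn)
    have h₂ := abs_le.1 (hN i₀ N le_rfl)
    rw [Real.dist_eq, abs_lt]
    constructor <;> linarith [h₁.1, h₁.2, h₂.1, h₂.2]
  obtain ⟨ℓ, hℓ⟩ := cauchySeq_tendsto_of_complete hc
  refine ⟨ℓ, fun i => ?_⟩
  have hd : Tendsto (fun n => u i n - u i₀ n) atTop (nhds 0) := by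
    rw [Metric.tendsto_atTop]
    intro ε hε
    obtain ⟨c, N, hN⟩ := h (ε / 3) (by positivity)
    refine ⟨N, fun n hn => ?_⟩
    have h₁ := abs_le.1 (hN i n hn)
    have h₂ := abs_le.1 (hN i₀ n hn)
    rw [Real.dist_eq, abs_lt]
    constructor <;> linarith [h₁.1, h₁.2, h₂.1, h₂.2]
  simpa using hd.add hℓ

lemma exists_forall_tendsto_div_of_almost_additive {θ K : ℝ} {g : ℕ → ℝ → ℝ}
    (hg : ∀ m n x, |g (m + n) x - g m x - g n (x + m * θ)| ≤ K)
    (hr : ∀ n, HasBoundedRemainder θ (g n)) :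
    ∃ ℓ : ℝ, ∀ x, Tendsto (fun n : ℕ => g n x / n) atTop (nhds ℓ) := by
  refine exists_forall_tendsto_of_uniform (u := fun x n => g n x / n) fun ε hε => ?_
  obtain ⟨m, hm⟩ := exists_nat_gt (max 0 (2 * K / ε))
  have hm₀ : (0 : ℝ) < m := (le_max_left _ _).trans_lt hm
  have hK : 2 * K < m * ε := (div_lt_iff₀ hε).1 ((le_max_right _ _).trans_lt hm)
  obtain ⟨C, B, hB⟩ := abs_sub_le_of_almost_additive hg hr m
  obtain ⟨N, hN⟩ := exists_nat_gt (max 0 (2 * B / (m * ε)))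
  refine ⟨C / m, N, fun x n hn => ?_⟩
  have hn' : (N : ℝ) ≤ n := by exact_mod_cast hn
  have hn₀ : (0 : ℝ) < n := ((le_max_left _ _).trans_lt hN).trans_le hn'
  have hBn : 2 * B < n * (m * ε) :=
    (div_lt_iff₀ (by positivity)).1 (((le_max_right _ _).trans_lt hN).trans_le hn')
  have e : g n x / n - C / m = (m * g n x - n * C) / (n * m) := by
    field_simp
  rw [e, abs_div, abs_of_pos (mul_pos hn₀ hm₀), div_le_iff₀ (mul_pos hn₀ hm₀)]
  nlinarith [hB n x, mul_lt_mul_of_pos_left hK hn₀]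

lemma exists_hasLevyConstant_rotWord {F : ℝ → ℤ} (hF : IsRounding F) {a b : ℕ} (ha : 0 < a)
    (hb : 0 < b) {θ : ℝ} (hθ : θ ∈ Set.Icc (0 : ℝ) 1) :
    ∃ ℓ : ℝ, ∀ x, HasLevyConstant (rotWord F a b θ x) ℓ :=
  exists_forall_tendsto_div_of_almost_additive
    (g := fun n x => Real.log (contQ (rotWord F a b θ x) n))
    (fun m n x => abs_log_contQ_add_sub_le (rotWord_pos ha hb F θ x)
      (rotWord_add F a b θ x m) n)
    (hF.hasBoundedRemainder_log_contQ a b hθ)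

lemma contQ_congr {w v : ℕ → ℕ} (h : ∀ n, w (n + 1) = v (n + 1)) : ∀ n, contQ w n = contQ v n
  | 0 => rfl
  | 1 => h 0
  | n + 2 => by rw [contQ, contQ, h, contQ_congr h n, contQ_congr h (n + 1)]

lemma mechWord_self_eq_mechWord'_self (a b : ℕ) {θ : ℝ} (hθ : Irrational θ) (n : ℕ) :
    mechWord a b θ θ (n + 1) = mechWord' a b θ θ (n + 1) := by
  have key : ∀ k : ℕ, ⌈((k : ℝ) + 1) * θ⌉ = ⌊((k : ℝ) + 1) * θ⌋ + 1 := by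
    intro k
    have hirr : Irrational (((k : ℝ) + 1) * θ) := by
      simpa using hθ.natCast_mul (Nat.succ_ne_zero k)
    rw [Int.ceil_eq_iff]
    push_cast
    refine ⟨?_, (Int.lt_floor_add_one _).le⟩
    have := lt_of_le_of_ne (Int.floor_le (((k : ℝ) + 1) * θ)) (hirr.ne_int _).symm
    linarith
  have e₁ : ((n + 1 : ℕ) : ℝ) * θ + θ = (((n + 1 : ℕ) : ℝ) + 1) * θ := by ring
  have e₂ : (((n + 1 : ℕ) : ℝ) - 1) * θ + θ = ((n : ℝ) + 1) * θ := by push_cast; ring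
  simp only [mechWord, mechWord', e₁, e₂, key, add_sub_add_right_eq_sub]

/-- Theorem `thm:Sturm`. Any Sturmian continued fraction over `{a,b}`
has a Lévy constant, and this constant depends only on the slope `θ` of the Sturmian
word of partial quotients, not on its intercept `ρ`. -/
theorem stmt6 (a b : ℕ) (ha : 0 < a) (hb : 0 < b) (hab : a ≠ b)
    (θ : ℝ) (hθ : Irrational θ) (hθI : θ ∈ Set.Icc (0 : ℝ) 1) :
    ∃ ℓ : ℝ, ∀ ρ ∈ Set.Ico (0 : ℝ) 1,
      HasLevyConstant (mechWord a b θ ρ) ℓ ∧ HasLevyConstant (mechWord' a b θ ρ) ℓ := by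
  obtain ⟨ℓ, hℓ⟩ := exists_hasLevyConstant_rotWord isRounding_floor ha hb hθI
  obtain ⟨ℓ', hℓ'⟩ := exists_hasLevyConstant_rotWord isRounding_ceil ha hb hθI
  simp only [← mechWord_eq_rotWord] at hℓ
  simp only [← mechWord'_eq_rotWord] at hℓ'
  have heq : ℓ' = ℓ := by
    refine tendsto_nhds_unique (hℓ' θ) ?_
    simpa only [HasLevyConstant, contQ_congr (mechWord_self_eq_mechWord'_self a b hθ)]
      using hℓ θ
  exact ⟨ℓ, fun ρ _ => ⟨hℓ ρ, heq ▸ hℓ' ρ⟩⟩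
end

section
/- Let a_1, ..., a_n be positive integers. Then there exists a unique positive real number μ such that T_n(μ) = T(a_1, ..., a_n), where T_n(x) is the trace of the n-th power of the matrix [[x,1],[1,0]] and T(a_1,...,a_n) is the trace of [[a_1,1],[1,0]]···[[a_n,1],[1,0]]. -/
open Filter Real Matrix

theorem traceWord_eq_trace_prod (L : List ℕ) :
    traceWord L = (L.map fun c : ℕ => cfMat (c : ℝ)).prod.trace := by
  simp [traceWord, ← List.map_eq_flatMap, Function.comp_def]

theorem cfMat_prod_bounds {l u : ℝ} (hl : 0 ≤ l) (L : List ℕ)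
    (h : ∀ x ∈ L, l ≤ (x : ℝ) ∧ (x : ℝ) ≤ u) (i j : Fin 2) :
    0 ≤ (cfMat l ^ L.length) i j ∧
      (cfMat l ^ L.length) i j ≤ (L.map fun c : ℕ => cfMat (c : ℝ)).prod i j ∧
      (L.map fun c : ℕ => cfMat (c : ℝ)).prod i j ≤ (cfMat u ^ L.length) i j := by
  induction L generalizing i with
  | nil => fin_cases i <;> fin_cases j <;> simp
  | cons a t ih =>
    obtain ⟨h1, h2⟩ := h a (by simp)
    have ih' := ih fun x hx => h x (by simp [hx])
    obtain ⟨p1, p2, p3⟩ := ih' 0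
    obtain ⟨q1, q2, q3⟩ := ih' 1
    simp only [List.length_cons, pow_succ', List.map_cons, List.prod_cons, Matrix.mul_apply,
      Fin.sum_univ_two]
    have ha : (0 : ℝ) ≤ a := hl.trans h1
    have hu : 0 ≤ u := ha.trans h2
    have m0 := mul_nonneg hl p1
    have m1 := mul_le_mul h1 p2 p1 ha
    have m2 := mul_le_mul h2 p3 (p1.trans p2) hu
    fin_cases i
    · simp only [cfMat, Fin.zero_eta, of_apply, cons_val', cons_val_zero, cons_val_one,
        cons_val_fin_one, one_mul] at *
      exact ⟨by linarith, by linarith, by linarith⟩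
    · simpa [cfMat] using ih' 0

theorem Tpoly_le_traceWord_le {l u : ℝ} (hl : 0 ≤ l) (L : List ℕ)
    (h : ∀ x ∈ L, l ≤ (x : ℝ) ∧ (x : ℝ) ≤ u) :
    Tpoly L.length l ≤ traceWord L ∧ traceWord L ≤ Tpoly L.length u := by
  have h0 := cfMat_prod_bounds hl L h 0 0
  have h1 := cfMat_prod_bounds hl L h 1 1
  simp only [Tpoly, traceWord_eq_trace_prod, Matrix.trace_fin_two]
  exact ⟨by linarith, by linarith⟩

theorem Tpoly_zero (x : ℝ) : Tpoly 0 x = 2 := by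
  simp [Tpoly]

theorem Tpoly_one (x : ℝ) : Tpoly 1 x = x := by
  simp [Tpoly, cfMat, Matrix.trace_fin_two]

theorem Tpoly_add_two (n : ℕ) (x : ℝ) :
    Tpoly (n + 2) x = x * Tpoly (n + 1) x + Tpoly n x := by
  simp only [Tpoly, pow_succ, Matrix.trace_fin_two, Matrix.mul_apply, Fin.sum_univ_two]
  simp [cfMat]
  ring

theorem continuous_Tpoly (n : ℕ) : Continuous (Tpoly n) := by
  have h : Continuous cfMat := by
    refine continuous_matrix fun i j => ?_
    fin_cases i <;> fin_cases j <;> simp [cfMat] <;> fun_prop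
  exact (h.pow n).matrix_trace

theorem Tpoly_pos {x : ℝ} (hx : 0 < x) (n : ℕ) : 0 < Tpoly n x := by
  induction n using Nat.twoStepInduction with
  | zero => simp [Tpoly_zero]
  | one => simpa [Tpoly_one]
  | more n h0 h1 => rw [Tpoly_add_two]; positivity

theorem Tpoly_succ_lt {x y : ℝ} (hx : 0 < x) (hxy : x < y) (n : ℕ) :
    Tpoly (n + 1) x < Tpoly (n + 1) y ∧ Tpoly n x ≤ Tpoly n y := by
  induction n with
  | zero => simp [Tpoly_zero, Tpoly_one, hxy]
  | succ n ih =>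
    refine ⟨?_, ih.1.le⟩
    rw [Tpoly_add_two, Tpoly_add_two]
    have := mul_lt_mul'' hxy ih.1 hx.le (Tpoly_pos hx _).le
    linarith [ih.2]

theorem strictMonoOn_Tpoly {n : ℕ} (hn : n ≠ 0) : StrictMonoOn (Tpoly n) (Set.Ioi 0) := by
  obtain ⟨m, rfl⟩ := Nat.exists_eq_succ_of_ne_zero hn
  exact fun x hx y _ hxy => (Tpoly_succ_lt hx hxy m).1

/-- For positive integers `a₁, …, a_n` (a nonempty list `L`), there is
a unique positive real `μ` with `𝐓_n(μ) = T(a₁, …, a_n)`. -/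
theorem stmt9 (L : List ℕ) (hL : L ≠ []) (hpos : ∀ x ∈ L, 0 < x) :
    ∃! μ : ℝ, 0 < μ ∧ Tpoly L.length μ = traceWord L := by
  have hb : ∀ x ∈ L, (1 : ℝ) ≤ (x : ℝ) ∧ (x : ℝ) ≤ ((L.sum : ℕ) : ℝ) := fun x hx =>
    ⟨by exact_mod_cast hpos x hx, by exact_mod_cast List.le_sum_of_mem hx⟩
  obtain ⟨a, ha⟩ := List.exists_mem_of_ne_nil L hL
  obtain ⟨μ, hμ, hμT⟩ := intermediate_value_Icc ((hb a ha).1.trans (hb a ha).2)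
    (continuous_Tpoly L.length).continuousOn (Tpoly_le_traceWord_le zero_le_one L hb)
  refine ⟨μ, ⟨zero_lt_one.trans_le hμ.1, hμT⟩, fun ν ⟨hν, hνT⟩ => ?_⟩
  exact (strictMonoOn_Tpoly (List.length_pos_iff.2 hL).ne').injOn hν
    (zero_lt_one.trans_le hμ.1) (hνT.trans hμT.symm)
end

section
/- Let p/q and p'/q' be rational numbers in [0,1] with |pq' − p'q| = 1 and q ≥ q'. Then T(w_{(p+p')/(q+q')}) = T(w_{p/q})·T(w_{p'/q'}) − (−1)^{q'}·T(w_{(p−p')/(q−q')}), and moreover T(w_{(p+p')/(q+q')}) ≥ T(w_{p/q}) + 1. Here w_{±1/0} denotes the empty word and T(w_{±1/0}) := 2. -/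
open Filter Real Matrix

/-- The matrix attached to a word: the product of the matrices of its letters. -/
def wordMat (L : List ℕ) : Matrix (Fin 2) (Fin 2) ℝ := (L.map fun c => cfMat (c : ℝ)).prod

theorem wordMat_append (u v : List ℕ) : wordMat (u ++ v) = wordMat u * wordMat v := by
  simp [wordMat]

theorem traceWord_append_comm (u v : List ℕ) : traceWord (u ++ v) = traceWord (v ++ u) := by
  change (wordMat (u ++ v)).trace = (wordMat (v ++ u)).trace
  rw [wordMat_append, wordMat_append, Matrix.trace_mul_comm]

theorem det_wordMat (L : List ℕ) : (wordMat L).det = (-1) ^ L.length := by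
  induction L with
  | nil => simp [wordMat]
  | cons c t ih =>
    have h : wordMat (c :: t) = cfMat c * wordMat t := by simp [wordMat]
    rw [h, Matrix.det_mul, ih, List.length_cons, pow_succ']
    simp [cfMat, Matrix.det_fin_two]

theorem wordMat_cons_apply (c : ℕ) (t : List ℕ) :
    wordMat (c :: t) 0 0 = c * wordMat t 0 0 + wordMat t 1 0 ∧
    wordMat (c :: t) 0 1 = c * wordMat t 0 1 + wordMat t 1 1 ∧
    wordMat (c :: t) 1 0 = wordMat t 0 0 ∧ wordMat (c :: t) 1 1 = wordMat t 0 1 := by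
  have h : wordMat (c :: t) = cfMat c * wordMat t := by simp [wordMat]
  rw [h]
  simp [cfMat, Matrix.mul_apply, Fin.sum_univ_two]

theorem wordMat_bounds (L : List ℕ) (hL : ∀ c ∈ L, 0 < c) :
    1 ≤ wordMat L 0 0 ∧ 0 ≤ wordMat L 0 1 ∧ 0 ≤ wordMat L 1 0 ∧ 0 ≤ wordMat L 1 1 ∧
      1 ≤ wordMat L 0 1 + wordMat L 1 1 := by
  induction L with
  | nil => simp [wordMat]
  | cons c t ih =>
    obtain ⟨h1, h2, h3, h4, h5⟩ := ih fun x hx => hL x (List.mem_cons_of_mem _ hx)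
    have hc : (1 : ℝ) ≤ c := by exact_mod_cast hL c List.mem_cons_self
    obtain ⟨e1, e2, e3, e4⟩ := wordMat_cons_apply c t
    rw [e1, e2, e3, e4]
    refine ⟨?_, ?_, ?_, ?_, ?_⟩ <;> nlinarith

theorem wordMat_cons_bounds (c : ℕ) (t : List ℕ) (hL : ∀ x ∈ c :: t, 0 < x) :
    1 ≤ wordMat (c :: t) 0 0 ∧ 1 ≤ wordMat (c :: t) 0 1 ∧ 1 ≤ wordMat (c :: t) 1 0 ∧
      0 ≤ wordMat (c :: t) 1 1 ∧
      wordMat (c :: t) 1 1 + 1 ≤ wordMat (c :: t) 0 1 + wordMat (c :: t) 1 0 := by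
  obtain ⟨h1, h2, h3, h4, h5⟩ := wordMat_bounds t fun x hx => hL x (List.mem_cons_of_mem _ hx)
  have hc : (1 : ℝ) ≤ c := by exact_mod_cast hL c List.mem_cons_self
  obtain ⟨e1, e2, e3, e4⟩ := wordMat_cons_apply c t
  rw [e1, e2, e3, e4]
  refine ⟨?_, ?_, ?_, ?_, ?_⟩ <;> nlinarith

theorem traceWord_add_one_le_append (u v : List ℕ) (hu : ∀ x ∈ u, 0 < x) (hv : ∀ x ∈ v, 0 < x)
    (hu0 : u ≠ []) (hv0 : v ≠ []) : traceWord u + 1 ≤ traceWord (u ++ v) := by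
  change (wordMat u).trace + 1 ≤ (wordMat (u ++ v)).trace
  rw [wordMat_append]
  obtain ⟨c, u, rfl⟩ := List.exists_cons_of_ne_nil hu0
  obtain ⟨x, v, rfl⟩ := List.exists_cons_of_ne_nil hv0
  obtain ⟨h1, h2, h3, h4, h5⟩ := wordMat_cons_bounds c u hu
  obtain ⟨k1, k2, k3, -, -⟩ := wordMat_cons_bounds x v hv
  obtain ⟨-, -, -, e4⟩ := wordMat_cons_apply x v
  have hv' : ∀ y ∈ v, 0 < y := fun y hy => hv y (List.mem_cons_of_mem _ hy)
  simp only [Matrix.trace_fin_two, Matrix.mul_apply, Fin.sum_univ_two]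
  rw [e4]
  rcases v with - | ⟨y, t⟩
  · have : wordMat [] 0 1 = 0 := by simp [wordMat]
    rw [this]
    nlinarith
  · obtain ⟨-, l2, -, -, -⟩ := wordMat_cons_bounds y t hv'
    nlinarith

/-- The identity `Tr(NPN) = Tr(NP) Tr(N) - det(N) Tr(P)` for words. -/
theorem traceWord_append_append (u v : List ℕ) :
    traceWord (v ++ (v ++ u)) =
      traceWord (v ++ u) * traceWord v - (-1) ^ v.length * traceWord u := by
  change (wordMat (v ++ (v ++ u))).trace =
    (wordMat (v ++ u)).trace * (wordMat v).trace - (-1) ^ v.length * (wordMat u).trace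
  rw [← det_wordMat, wordMat_append, wordMat_append]
  simp only [Matrix.trace_fin_two, Matrix.mul_apply, Fin.sum_univ_two, Matrix.det_fin_two]
  ring

theorem floor_natCast_mul_div (n p q : ℕ) :
    ⌊(n : ℝ) * ((p : ℝ) / q) + 0⌋ = ((n * p / q : ℕ) : ℤ) := by
  rw [add_zero, ← mul_div_assoc, ← Nat.cast_mul, ← Int.natCast_floor_eq_floor (by positivity),
    Nat.floor_div_eq_div]

theorem christoffel_eq (a b p q : ℕ) : christoffel a b p q =
    (List.range q).map fun n => if (n + 1) * p / q = n * p / q then a else b := by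
  refine List.map_congr_left fun n _ => ?_
  have h : (((n + 1 : ℕ) : ℝ) - 1) = n := by push_cast; ring
  simp only [mechWord, h, floor_natCast_mul_div]
  simp only [sub_eq_zero, Nat.cast_inj]

theorem mediant_div_left {p q p' q' n : ℕ} (hq : 0 < q) (hq' : 0 < q')
    (h : p' * q = p * q' + 1) (hn : n ≤ q) : n * (p + p') / (q + q') = n * p / q := by
  have h1 : n * p / q * q ≤ n * p := Nat.div_mul_le_self _ _
  have h2 : n * p < (n * p / q + 1) * q := Nat.lt_mul_of_div_lt (Nat.lt_succ_self _) hq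
  generalize n * p / q = k at *
  have e : n * (p + p') * q = n * p * (q + q') + n := by linear_combination n * h
  apply Nat.div_eq_of_lt_le
  · refine le_of_mul_le_mul_right ?_ hq
    rw [e]
    nlinarith [Nat.mul_le_mul_right (q + q') h1]
  · refine lt_of_mul_lt_mul_right ?_ hq.le
    rw [e]
    nlinarith [Nat.mul_le_mul_right (q + q') (Nat.succ_le_of_lt h2)]

theorem mediant_div_right {p q p' q' m : ℕ} (hq : 0 < q) (hq' : 0 < q')
    (h : p' * q = p * q' + 1) (hm : m ≤ q') :
    (q + m) * (p + p') / (q + q') = p + m * p' / q' := by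
  have h1 : m * p' / q' * q' ≤ m * p' := Nat.div_mul_le_self _ _
  have h2 : m * p' < (m * p' / q' + 1) * q' := Nat.lt_mul_of_div_lt (Nat.lt_succ_self _) hq'
  generalize m * p' / q' = k at *
  have e : (q + m) * (p + p') * q' + (q + m) = (q + q') * (m * p' + p * q' + 1) := by
    zify at h ⊢
    linear_combination (q' - m : ℤ) * h
  apply Nat.div_eq_of_lt_le
  · refine le_of_mul_le_mul_right ?_ hq'
    nlinarith [Nat.mul_le_mul_right (q + q') h1]
  · refine lt_of_mul_lt_mul_right ?_ hq'.le
    nlinarith [Nat.mul_le_mul_right (q + q') (Nat.succ_le_of_lt h2)]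

/-- Standard factorization: the Christoffel word of a mediant is the concatenation of the
Christoffel words of its Farey parents, the smaller slope first. -/
theorem christoffel_mediant (a b : ℕ) {p q p' q' : ℕ} (hq : 0 < q) (hq' : 0 < q')
    (h : p' * q = p * q' + 1) :
    christoffel a b (p + p') (q + q') = christoffel a b p q ++ christoffel a b p' q' := by
  simp only [christoffel_eq]
  rw [List.range_add, List.map_append, List.map_map]
  congr 1
  · refine List.map_congr_left fun n hn => ?_
    have hn := List.mem_range.1 hn
    rw [mediant_div_left hq hq' h hn.le, mediant_div_left hq hq' h hn]
  · refine List.map_congr_left fun m hm => ?_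
    have hm := List.mem_range.1 hm
    simp only [Function.comp_apply]
    rw [mediant_div_right hq hq' h hm.le, add_assoc, mediant_div_right hq hq' h hm]
    simp only [add_right_inj]

theorem length_christoffel (a b p q : ℕ) : (christoffel a b p q).length = q := by
  simp [christoffel]

theorem christoffel_pos {a b : ℕ} (ha : 0 < a) (hb : 0 < b) (p q : ℕ) :
    ∀ x ∈ christoffel a b p q, 0 < x := by
  intro x hx
  rw [christoffel_eq, List.mem_map] at hx
  obtain ⟨n, -, rfl⟩ := hx
  split_ifs <;> assumption

theorem christoffel_ne_nil (a b p : ℕ) {q : ℕ} (hq : 0 < q) : christoffel a b p q ≠ [] :=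
  List.ne_nil_of_length_pos (by rwa [length_christoffel])

/-- The trace of a mediant is computed from its Farey parents, in either order. -/
theorem Tw_mediant (a b : ℕ) {p q p' q' : ℕ} (hq : 0 < q) (hq' : 0 < q')
    (h : p * q' = p' * q + 1 ∨ p' * q = p * q' + 1) :
    Tw a b (p + p') (q + q') = traceWord (christoffel a b p q ++ christoffel a b p' q') := by
  unfold Tw
  rcases h with h | h
  · rw [add_comm p, add_comm q, christoffel_mediant a b hq' hq h, traceWord_append_comm]
  · rw [christoffel_mediant a b hq hq' h]

theorem le_of_farey {p q p' q' : ℕ} (hq' : 0 < q') (hlt : q' < q)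
    (h : p * q' = p' * q + 1 ∨ p' * q = p * q' + 1) : p' ≤ p := by
  by_contra! hpp
  rcases h with h | h <;> nlinarith

theorem Tw_mediant_of_lt (a b : ℕ) {p q p' q' : ℕ} (hq' : 0 < q') (hlt : q' < q)
    (h : p * q' = p' * q + 1 ∨ p' * q = p * q' + 1) :
    Tw a b (p + p') (q + q') =
      Tw a b p q * Tw a b p' q' - (-1 : ℝ) ^ q' * Tw a b (p - p') (q - q') := by
  obtain ⟨r, rfl⟩ := Nat.exists_eq_add_of_le (le_of_farey hq' hlt h)
  obtain ⟨s, rfl⟩ := Nat.exists_eq_add_of_lt hlt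
  set t := s + 1 with ht
  have ht0 : 0 < t := Nat.succ_pos s
  have hs : q' + s + 1 = q' + t := rfl
  rw [hs] at h ⊢
  simp only [Nat.add_sub_cancel_left]
  have key := traceWord_append_append (christoffel a b r t) (christoffel a b p' q')
  rw [length_christoffel] at key
  rcases h with h | h
  · have h' : r * q' = p' * t + 1 := by linarith
    have e := christoffel_mediant a b hq' ht0 h'
    rw [Tw_mediant a b (by omega) hq' (Or.inl h), traceWord_append_comm, Tw, Tw, Tw, e, key]
  · have h' : p' * t = r * q' + 1 := by linarith
    have e := christoffel_mediant a b ht0 hq' h'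
    rw [add_comm r, add_comm t] at e
    rw [Tw_mediant a b (by omega) hq' (Or.inr h), Tw, Tw, Tw, e,
      traceWord_append_comm (christoffel a b r t), List.append_assoc,
      traceWord_append_comm (christoffel a b r t), List.append_assoc, key]

/-- Lemma `lem:second`. For rationals `p/q`, `p'/q'` in `[0,1]` with
`|pq' - p'q| = 1` and `q ≥ q'`, one has
`T(w_{(p+p')/(q+q')}) = T(w_{p/q})·T(w_{p'/q'}) - (-1)^{q'}·T(w_{(p-p')/(q-q')})` and
`T(w_{(p+p')/(q+q')}) ≥ T(w_{p/q}) + 1` (with `T(w_{±1/0}) = 2`, the trace of the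
empty product, which is the value of `Tw` when the denominator is `0`). -/
theorem stmt11 (a b : ℕ) (ha : 0 < a) (hb : 0 < b) (hab : a ≠ b)
    (p q p' q' : ℕ) (hq' : 1 ≤ q') (hqq' : q' ≤ q) (hp : p ≤ q) (hp' : p' ≤ q')
    (hdet : (p : ℤ) * q' - p' * q = 1 ∨ (p : ℤ) * q' - p' * q = -1) :
    Tw a b (p + p') (q + q') =
        Tw a b p q * Tw a b p' q' - (-1 : ℝ) ^ q' * Tw a b (p - p') (q - q') ∧
      Tw a b p q + 1 ≤ Tw a b (p + p') (q + q') := by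
  have h : p * q' = p' * q + 1 ∨ p' * q = p * q' + 1 := by
    rcases hdet with h | h
    · left; zify; linarith
    · right; zify; linarith
  refine ⟨?_, ?_⟩
  · rcases hqq'.lt_or_eq with hlt | rfl
    · exact Tw_mediant_of_lt a b hq' hlt h
    · have hq1 : q' = 1 := by
        refine Nat.dvd_one.1 ?_
        rcases h with h | h
        · exact (Nat.dvd_add_right (Dvd.intro_left p' rfl)).1 (h ▸ Dvd.intro_left p rfl)
        · exact (Nat.dvd_add_right (Dvd.intro_left p rfl)).1 (h ▸ Dvd.intro_left p' rfl)
      subst hq1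
      rw [Tw_mediant a b one_pos one_pos h]
      obtain ⟨rfl, rfl⟩ | ⟨rfl, rfl⟩ : p = 1 ∧ p' = 0 ∨ p = 0 ∧ p' = 1 := by omega
      all_goals
        simp [Tw, christoffel_eq, traceWord, cfMat, Matrix.trace_fin_two]
        ring
  · have hq : 0 < q := by omega
    rw [Tw_mediant a b hq hq' h]
    exact traceWord_add_one_le_append _ _ (christoffel_pos ha hb _ _) (christoffel_pos ha hb _ _)
      (christoffel_ne_nil a b p hq) (christoffel_ne_nil a b p' hq')
end
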